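/- arXiv:1410.2164 — 4 statements merged into one kernel-verified Lean document; each statement's English description precedes it below -/
import Mathlib

section
/- Suppose G belongs to the family F_n. Then G is determined by its generalized spectrum: for every n×n integer matrix B that is symmetric, has all diagonal entries 0 and every entry 0 or 1, if A and B have the same characteristic polynomial and J − I − A and J − I − B have the same characteristic polynomial (J the all-one matrix), then there exists a permutation matrix P with Pᵀ A P = B. -/
open Matrix

theorem charpolyRev_neg_eq_comp {n R : Type*} [Fintype n] [DecidableEq n] [CommRing R]
    (M : Matrix n n R) : (-M).charpolyRev = M.charpolyRev.comp (-Polynomial.X) := by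
  rw [charpolyRev, charpolyRev, ← Polynomial.coe_compRingHom_apply, RingHom.map_det]
  congr 1
  ext1 i j
  by_cases h : i = j <;> simp [h]

theorem charpolyRev_eq_of_charpoly_eq {n R : Type*} [Fintype n] [DecidableEq n] [CommRing R]
    {M N : Matrix n n R} (h : M.charpoly = N.charpoly) : M.charpolyRev = N.charpolyRev := by
  rw [← reverse_charpoly, h, reverse_charpoly]

theorem charpolyRev_sub_allOne_eq {n R : Type*} [Fintype n] [DecidableEq n] [CommRing R]
    {A B J : Matrix n n R} (h : (J - 1 - A).charpoly = (J - 1 - B).charpoly) :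
    (A - J).charpolyRev = (B - J).charpolyRev := by
  have key : ∀ M : Matrix n n R,
      (M - J).charpolyRev = (J - 1 - M - scalar n (-1)).charpolyRev.comp (-Polynomial.X) := by
    intro M
    rw [← charpolyRev_neg_eq_comp]
    congr 1
    have hs : scalar n (-1 : R) = -1 := by rw [map_neg, map_one]
    rw [hs]
    abel
  rw [key A, key B]
  congr 1
  apply charpolyRev_eq_of_charpoly_eq
  rw [charpoly_sub_scalar, charpoly_sub_scalar, h]

/-- The generating function of the number of walks, over all starting points. -/
theorem charpolyRev_sub_allOne {n : ℕ} {R : Type*} [CommRing R] (A : Matrix (Fin n) (Fin n) R) :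
    ((A - Matrix.of fun _ _ => 1).charpolyRev : PowerSeries R) =
      (A.charpolyRev : PowerSeries R) *
        (1 + PowerSeries.X * PowerSeries.mk fun k => (1 : Fin n → R) ⬝ᵥ (A ^ k *ᵥ 1)) := by
  set M : Matrix (Fin n) (Fin n) (PowerSeries R) :=
    1 - (PowerSeries.X : PowerSeries R) • A.map (PowerSeries.C (R := R)) with hM
  have hdet : ∀ N : Matrix (Fin n) (Fin n) R, (N.charpolyRev : PowerSeries R) =
      (1 - (PowerSeries.X : PowerSeries R) • N.map (PowerSeries.C (R := R))).det := by
    intro N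
    rw [charpolyRev, ← Polynomial.coeToPowerSeries.ringHom_apply, RingHom.map_det]
    congr 1
    ext1 i j
    by_cases h : i = j <;> simp [h] <;> exact mul_comm _ _
  have hunit : IsUnit M.det := by
    rw [← hdet A, PowerSeries.isUnit_iff_constantCoeff]
    have := eval_charpolyRev (M := A)
    rw [← Polynomial.coeff_zero_eq_eval_zero] at this
    simp [this]
  set v : Fin n → PowerSeries R := fun i => PowerSeries.mk fun k => (A ^ k *ᵥ (1 : Fin n → R)) i
  have hMv : M *ᵥ v = 1 := by
    ext i k
    cases k with
    | zero => simp [hM, v, sub_mulVec, smul_mulVec]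
    | succ k =>
      simp only [hM, v, sub_mulVec, smul_mulVec, one_mulVec, Pi.sub_apply, Pi.smul_apply,
        map_sub, smul_eq_mul, PowerSeries.coeff_succ_X_mul, PowerSeries.coeff_mk, Pi.one_apply,
        PowerSeries.coeff_one]
      simp only [mulVec, dotProduct, map_sum, map_apply, PowerSeries.coeff_C_mul,
        PowerSeries.coeff_mk, pow_succ', Matrix.mul_apply]
      simp only [Pi.one_apply, mul_one, Finset.mul_sum]
      rw [Finset.sum_comm]
      simp
  rw [hdet, hdet, ← hM]
  have hsplit : (1 - (PowerSeries.X : PowerSeries R) •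
      (A - Matrix.of fun _ _ => 1).map (PowerSeries.C (R := R))) =
      M + replicateCol Unit (1 : Fin n → PowerSeries R) *
        replicateRow Unit (fun _ => (PowerSeries.X : PowerSeries R)) := by
    ext1 i j
    simp [hM, Matrix.mul_apply]
    ring
  have hinv : M⁻¹ *ᵥ 1 = v := by
    rw [← hMv, mulVec_mulVec, nonsing_inv_mul _ hunit, one_mulVec]
  rw [hsplit, det_add_replicateCol_mul_replicateRow hunit]
  rw [Matrix.mul_assoc, ← replicateCol_mulVec, hinv]
  simp only [det_unique, Matrix.add_apply, one_apply_eq, Matrix.mul_apply, replicateRow_apply,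
    replicateCol_apply, ← Finset.mul_sum]
  congr 3
  ext k
  simp [v, dotProduct]

theorem walk_count_eq {n : ℕ} {A B : Matrix (Fin n) (Fin n) ℤ} (h : A.charpoly = B.charpoly)
    (h' : ((Matrix.of fun _ _ => (1 : ℤ)) - 1 - A).charpoly =
      ((Matrix.of fun _ _ => (1 : ℤ)) - 1 - B).charpoly) (k : ℕ) :
    (1 : Fin n → ℤ) ⬝ᵥ (A ^ k *ᵥ 1) = 1 ⬝ᵥ (B ^ k *ᵥ 1) := by
  have h1 := charpolyRev_sub_allOne A
  rw [charpolyRev_sub_allOne_eq h', charpolyRev_sub_allOne B,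
    ← charpolyRev_eq_of_charpoly_eq h] at h1
  have hne : (A.charpolyRev : PowerSeries ℤ) ≠ 0 := by
    intro h0
    have := eval_charpolyRev (M := A)
    rw [← Polynomial.coeff_zero_eq_eval_zero] at this
    rw [Polynomial.coe_eq_zero_iff.1 h0] at this
    simp at this
  have h2 := mul_left_cancel₀ PowerSeries.X_ne_zero (add_left_cancel (mul_left_cancel₀ hne h1))
  have := congrArg (PowerSeries.coeff k) h2
  simpa using this.symm

/-- The walk-matrix `[e, Ae, …, A^{n-1}e]`. -/
def walkMatrix {n : ℕ} {R : Type*} [CommRing R] (A : Matrix (Fin n) (Fin n) R) :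
    Matrix (Fin n) (Fin n) R :=
  Matrix.of fun i j => (A ^ (j : ℕ) *ᵥ 1) i

theorem transpose_mulVec_dotProduct {m n R : Type*} [Fintype m] [Fintype n] [CommRing R]
    (M : Matrix m n R) (x : m → R) (y : n → R) : (Mᵀ *ᵥ x) ⬝ᵥ y = x ⬝ᵥ (M *ᵥ y) := by
  rw [mulVec_transpose, ← dotProduct_mulVec]

theorem walkMatrix_mulVec_apply {n : ℕ} {R : Type*} [CommRing R] (A : Matrix (Fin n) (Fin n) R)
    (y : Fin n → R) : walkMatrix A *ᵥ y = ∑ j : Fin n, y j • (A ^ (j : ℕ) *ᵥ 1) := by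
  ext i
  simp [walkMatrix, mulVec, dotProduct, mul_comm]

theorem walkMatrix_transpose_mulVec_apply {n : ℕ} {R : Type*} [CommRing R]
    (A : Matrix (Fin n) (Fin n) R) (y : Fin n → R) (j : Fin n) :
    ((walkMatrix A)ᵀ *ᵥ y) j = (A ^ (j : ℕ) *ᵥ 1) ⬝ᵥ y := by
  rfl

theorem walkMatrix_map {n : ℕ} {R S : Type*} [CommRing R] [CommRing S] (f : R →+* S)
    (A : Matrix (Fin n) (Fin n) R) : walkMatrix (A.map f) = (walkMatrix A).map f := by
  ext i j
  simp only [walkMatrix, of_apply, map_apply]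
  rw [RingHom.map_mulVec, ← RingHom.mapMatrix_apply f (A ^ _), map_pow]
  congr 2
  ext
  simp

theorem pow_mulVec_dotProduct {n R : Type*} [Fintype n] [DecidableEq n] [CommRing R]
    {A : Matrix n n R} (hA : Aᵀ = A) (k : ℕ) (x y : n → R) :
    (A ^ k *ᵥ x) ⬝ᵥ y = x ⬝ᵥ (A ^ k *ᵥ y) := by
  rw [← transpose_mulVec_dotProduct, transpose_pow, hA]

theorem pow_dotProduct_pow {n R : Type*} [Fintype n] [DecidableEq n] [CommRing R]
    {A : Matrix n n R} (hA : Aᵀ = A) (i j : ℕ) (x y : n → R) :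
    (A ^ i *ᵥ x) ⬝ᵥ (A ^ j *ᵥ y) = x ⬝ᵥ (A ^ (i + j) *ᵥ y) := by
  rw [pow_mulVec_dotProduct hA, mulVec_mulVec, pow_add]

/-- An integral orthogonal matrix with all row sums equal to one is a permutation matrix. -/
theorem exists_permMatrix_eq {n : Type*} [Fintype n] [DecidableEq n] {P : Matrix n n ℤ}
    (hP : Pᵀ * P = 1) (he : P *ᵥ 1 = 1) : ∃ σ : Equiv.Perm n, σ.permMatrix ℤ = P := by
  have hP' : P * Pᵀ = 1 := mul_eq_one_comm.1 hP
  have hrow : ∀ i, ∑ j, P i j * P i j = 1 := fun i => by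
    simpa [Matrix.mul_apply] using congrFun (congrFun hP' i) i
  have hsum : ∀ i, ∑ j, P i j = 1 := fun i => by
    simpa [mulVec, dotProduct] using congrFun he i
  have h01 : ∀ i j, P i j = 0 ∨ P i j = 1 := by
    intro i j
    have h0 : ∑ j, (P i j * P i j - P i j) = 0 := by
      rw [Finset.sum_sub_distrib, hrow, hsum, sub_self]
    rw [Finset.sum_eq_zero_iff_of_nonneg] at h0
    · have := h0 j (Finset.mem_univ j)
      have h : P i j * (P i j - 1) = 0 := by linarith
      rcases mul_eq_zero.1 h with h | h
      · exact Or.inl h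
      · exact Or.inr (by linarith)
    · intro j _
      rcases le_or_gt (P i j) 0 with h | h <;> nlinarith
  have hex : ∀ i, ∃ j, P i j = 1 := by
    intro i
    by_contra! hne
    have := hsum i
    rw [Finset.sum_eq_zero fun j _ => (h01 i j).resolve_right (hne j)] at this
    exact zero_ne_one this
  choose f hf using hex
  have huniq : ∀ i j, P i j = 1 → j = f i := by
    intro i j hij
    by_contra hne
    have h1 : ∑ k ∈ ({j, f i} : Finset n), P i k ≤ ∑ k, P i k :=
      Finset.sum_le_sum_of_subset_of_nonneg (Finset.subset_univ _) fun k _ _ => by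
        rcases h01 i k with h | h <;> simp [h]
    rw [Finset.sum_pair hne, hij, hf, hsum] at h1
    norm_num at h1
  have hinj : Function.Injective f := by
    intro i i' h
    by_contra hne
    have h1 : ∑ j, P i j * P i' j = 0 := by
      simpa [Matrix.mul_apply, hne] using congrFun (congrFun hP' i) i'
    have h2 := (Finset.sum_eq_zero_iff_of_nonneg fun j _ => by
      rcases h01 i j with h | h <;> rcases h01 i' j with h' | h' <;> simp [h, h']).1 h1
        (f i) (Finset.mem_univ _)
    rw [hf, h, hf] at h2
    norm_num at h2
  refine ⟨Equiv.ofBijective f (Finite.injective_iff_bijective.1 hinj), ?_⟩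
  ext i j
  simp only [Equiv.Perm.permMatrix, PEquiv.toMatrix_apply, Equiv.toPEquiv_apply,
    Equiv.ofBijective_apply, Option.mem_some_iff]
  split_ifs with h
  · rw [← h, hf]
  · exact ((h01 i j).resolve_right fun h' => h (huniq i j h').symm).symm

/-- A rational matrix is integral as soon as no prime can be cancelled from the
denominator in vain. -/
theorem exists_int_matrix_eq {m n : Type*} [Fintype m] [Fintype n] (Q : Matrix m n ℚ)
    (h : ∀ (p : ℕ) (l : ℤ) (M : Matrix m n ℤ), p.Prime → (p : ℤ) ∣ l →
      M.map (Int.cast : ℤ → ℚ) = (l : ℚ) • Q → ∀ i j, (p : ℤ) ∣ M i j) :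
    ∃ P : Matrix m n ℤ, P.map (Int.cast : ℤ → ℚ) = Q := by
  classical
  have hex : ∃ l : ℕ, 0 < l ∧ ∃ M : Matrix m n ℤ, M.map (Int.cast : ℤ → ℚ) = (l : ℚ) • Q := by
    refine ⟨∏ i, ∏ j, (Q i j).den, Finset.prod_pos fun i _ => Finset.prod_pos fun j _ =>
      (Q i j).den_pos, ?_⟩
    have : ∀ i j, ∃ z : ℤ, (z : ℚ) = ((∏ i, ∏ j, (Q i j).den : ℕ) : ℚ) * Q i j := by
      intro i j
      have hd : (Q i j).den ∣ ∏ i, ∏ j, (Q i j).den :=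
        (Finset.dvd_prod_of_mem (fun j => (Q i j).den) (Finset.mem_univ j)).trans
          (Finset.dvd_prod_of_mem (fun i => ∏ j, (Q i j).den) (Finset.mem_univ i))
      obtain ⟨c, hc⟩ := hd
      refine ⟨c * (Q i j).num, ?_⟩
      rw [hc]
      have := Rat.den_mul_eq_num (Q i j)
      push_cast
      rw [← this]
      ring
    choose M hM using this
    exact ⟨Matrix.of M, by ext i j; simpa using hM i j⟩
  obtain ⟨hpos, M, hM⟩ := Nat.find_spec hex
  set l := Nat.find hex with hl
  by_cases h1 : l = 1
  · exact ⟨M, by rw [hM, h1]; simp⟩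
  · obtain ⟨p, hp, l', hl'⟩ := Nat.exists_prime_and_dvd h1
    have hdvd := h p l M hp ⟨l', by rw [hl']; push_cast; rfl⟩ (by rw [hM]; simp)
    choose M' hM' using hdvd
    have hl'pos : 0 < l' := Nat.pos_of_ne_zero fun h0 => by rw [h0, mul_zero] at hl'; omega
    have hlt : l' < l := by
      rw [hl']
      exact lt_mul_of_one_lt_left hl'pos hp.one_lt
    refine absurd ⟨hl'pos, Matrix.of M', ?_⟩ (Nat.find_min hex hlt)
    ext i j
    have h2 := congrFun (congrFun hM i) j
    have hp0 : (p : ℚ) ≠ 0 := by exact_mod_cast hp.ne_zero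
    simp only [map_apply, hM', Matrix.smul_apply, smul_eq_mul, hl', of_apply] at h2 ⊢
    push_cast at h2
    apply mul_left_cancel₀ hp0
    rw [h2]
    ring

theorem exists_perm_of_walk_count_eq {n : ℕ} {A B : Matrix (Fin n) (Fin n) ℤ}
    (hA : Aᵀ = A) (hB : Bᵀ = B)
    (hs : ∀ k, (1 : Fin n → ℤ) ⬝ᵥ (A ^ k *ᵥ 1) = 1 ⬝ᵥ (B ^ k *ᵥ 1))
    (hdet : (walkMatrix A).det ≠ 0)
    (hprime : ∀ (p : ℕ) (u : Fin n → ℤ), p.Prime → (∀ k, (p : ℤ) ∣ u ⬝ᵥ (A ^ k *ᵥ 1)) →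
      (∀ k, (p : ℤ) ^ 2 ∣ u ⬝ᵥ (A ^ k *ᵥ u)) → ∀ i, (p : ℤ) ∣ u i) :
    ∃ σ : Equiv.Perm (Fin n), (σ.permMatrix ℤ)ᵀ * A * σ.permMatrix ℤ = B := by
  have hgram : (walkMatrix A)ᵀ * walkMatrix A = (walkMatrix B)ᵀ * walkMatrix B := by
    ext i j
    change (A ^ (i : ℕ) *ᵥ 1) ⬝ᵥ (A ^ (j : ℕ) *ᵥ 1) = (B ^ (i : ℕ) *ᵥ 1) ⬝ᵥ (B ^ (j : ℕ) *ᵥ 1)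
    rw [pow_dotProduct_pow hA, pow_dotProduct_pow hB, hs]
  have hdetB : (walkMatrix B).det ≠ 0 := by
    intro h0
    have := congrArg det hgram
    simp only [det_mul, det_transpose, h0, mul_zero, mul_self_eq_zero] at this
    exact hdet this
  let f := Int.castRingHom ℚ
  set a := A.map f with ha
  set b := B.map f with hb
  set e : Fin n → ℚ := 1
  have hata : aᵀ = a := by rw [ha, ← transpose_map, hA]
  have hbtb : bᵀ = b := by rw [hb, ← transpose_map, hB]
  have hdeta : IsUnit (walkMatrix a).det := by
    rw [ha, walkMatrix_map, ← RingHom.mapMatrix_apply, ← RingHom.map_det]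
    exact isUnit_iff_ne_zero.2 (by simpa [f] using hdet)
  have hdetb : IsUnit (walkMatrix b).det := by
    rw [hb, walkMatrix_map, ← RingHom.mapMatrix_apply, ← RingHom.map_det]
    exact isUnit_iff_ne_zero.2 (by simpa [f] using hdetB)
  have hgram' : (walkMatrix a)ᵀ * walkMatrix a = (walkMatrix b)ᵀ * walkMatrix b := by
    rw [ha, hb, walkMatrix_map, walkMatrix_map, ← transpose_map, ← transpose_map,
      ← Matrix.map_mul, hgram, Matrix.map_mul]
  have hmapow : ∀ (C : Matrix (Fin n) (Fin n) ℤ) (k : ℕ), C.map f ^ k = (C ^ k).map f := by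
    intro C k
    rw [← RingHom.mapMatrix_apply, ← map_pow, RingHom.mapMatrix_apply]
  have hmulVec : ∀ (C : Matrix (Fin n) (Fin n) ℤ) (k : ℕ) (y : Fin n → ℤ),
      C.map f ^ k *ᵥ (f ∘ y) = f ∘ (C ^ k *ᵥ y) := by
    intro C k y
    ext i
    rw [hmapow, Function.comp_apply, RingHom.map_mulVec]
  have hcast : ∀ (C : Matrix (Fin n) (Fin n) ℤ) (k : ℕ) (x y : Fin n → ℤ),
      ((x ⬝ᵥ (C ^ k *ᵥ y) : ℤ) : ℚ) = (f ∘ x) ⬝ᵥ (C.map f ^ k *ᵥ (f ∘ y)) := by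
    intro C k x y
    rw [hmulVec]
    simp [dotProduct, f]
  have hfone : f ∘ (1 : Fin n → ℤ) = e := by ext; simp [e]
  have hs' : ∀ k, e ⬝ᵥ (a ^ k *ᵥ e) = e ⬝ᵥ (b ^ k *ᵥ e) := by
    intro k
    rw [← hfone, ha, hb, ← hcast, ← hcast, hs]
  set Q := walkMatrix a * (walkMatrix b)⁻¹ with hQ
  have hQW : Q * walkMatrix b = walkMatrix a := nonsing_inv_mul_cancel_right _ _ hdetb
  have hQQ : Qᵀ * Q = 1 := by
    rw [hQ, transpose_mul, ← Matrix.mul_assoc, Matrix.mul_assoc _ _ (walkMatrix a), hgram',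
      transpose_nonsing_inv, ← Matrix.mul_assoc, nonsing_inv_mul _ (by rwa [det_transpose]),
      Matrix.one_mul, mul_nonsing_inv _ hdetb]
  have hWQ : (walkMatrix a)ᵀ * Q = (walkMatrix b)ᵀ := by
    rw [← hQW, transpose_mul, Matrix.mul_assoc, hQQ, Matrix.mul_one]
  have hinj : ∀ x y : Fin n → ℚ, (walkMatrix a)ᵀ *ᵥ x = (walkMatrix a)ᵀ *ᵥ y → x = y := by
    apply mulVec_injective_of_isUnit
    rw [isUnit_iff_isUnit_det, det_transpose]
    exact hdeta
  have hQpow : ∀ k, Q *ᵥ (b ^ k *ᵥ e) = a ^ k *ᵥ e := by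
    intro k
    apply hinj
    rw [mulVec_mulVec, hWQ]
    ext j
    rw [walkMatrix_transpose_mulVec_apply, walkMatrix_transpose_mulVec_apply,
      pow_dotProduct_pow hata, pow_dotProduct_pow hbtb, hs']
  have hcomm : a * Q = Q * b := by
    have : a * Q * walkMatrix b = Q * b * walkMatrix b := by
      rw [Matrix.mul_assoc, hQW, Matrix.mul_assoc]
      ext i j
      have h1 : (a * walkMatrix a) i j = (a *ᵥ (a ^ (j : ℕ) *ᵥ e)) i := rfl
      have h2 : (Q * (b * walkMatrix b)) i j = (Q *ᵥ (b *ᵥ (b ^ (j : ℕ) *ᵥ e))) i := rfl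
      rw [h1, h2, mulVec_mulVec, ← pow_succ', mulVec_mulVec _ b, ← pow_succ', hQpow]
    have h3 := congrArg (· * (walkMatrix b)⁻¹) this
    simpa only [mul_nonsing_inv_cancel_right _ _ hdetb] using h3
  have hcommk : ∀ k, a ^ k * Q = Q * b ^ k := by
    intro k
    induction k with
    | zero => simp
    | succ k ih => rw [pow_succ, Matrix.mul_assoc, hcomm, ← Matrix.mul_assoc, ih,
        Matrix.mul_assoc, ← pow_succ]
  have hQe : Q *ᵥ e = e := by simpa using hQpow 0
  have hQA : ∀ k, Qᵀ * a ^ k * Q = b ^ k := by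
    intro k
    rw [Matrix.mul_assoc, hcommk, ← Matrix.mul_assoc, hQQ, Matrix.one_mul]
  obtain ⟨P, hP⟩ := exists_int_matrix_eq Q (by
    intro p l M hp hpl hM i j
    have hcol : f ∘ (fun i => M i j) = (l : ℚ) • Q.col j := by
      ext i
      simpa [f] using congrFun (congrFun hM i) j
    refine hprime p (fun i => M i j) hp (fun k => hpl.trans ⟨(B ^ k *ᵥ 1) j, ?_⟩)
      (fun k => (pow_dvd_pow_of_dvd hpl 2).trans ⟨(B ^ k) j j, ?_⟩) i
    · have h1 : Qᵀ *ᵥ (a ^ k *ᵥ e) = f ∘ (B ^ k *ᵥ 1) := by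
        rw [← hQpow, mulVec_mulVec, hQQ, one_mulVec, ← hmulVec, hfone]
      have h2 := congrFun h1 j
      apply Int.cast_injective (α := ℚ)
      rw [hcast, hcol, hfone, smul_dotProduct, smul_eq_mul, Int.cast_mul]
      exact congrArg _ h2
    · have h1 : Q.col j ⬝ᵥ (a ^ k *ᵥ Q.col j) = (Qᵀ * a ^ k * Q) j j := by
        rw [Matrix.mul_assoc]
        rfl
      apply Int.cast_injective (α := ℚ)
      rw [hcast, hcol, mulVec_smul, smul_dotProduct, dotProduct_smul, h1, hQA, hb, hmapow]
      simp [f]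
      ring)
  have hPmap : P.map f = Q := hP
  have hfinj : Function.Injective f := Int.cast_injective
  have hPP : Pᵀ * P = 1 := by
    apply Matrix.map_injective hfinj
    beta_reduce
    rw [Matrix.map_mul, transpose_map, hPmap, hQQ]
    simp
  have hPe : P *ᵥ 1 = 1 := by
    ext i
    apply hfinj
    rw [RingHom.map_mulVec, hPmap, hfone, hQe]
    simp [e]
  have hPA : Pᵀ * A * P = B := by
    apply Matrix.map_injective hfinj
    beta_reduce
    rw [Matrix.map_mul, Matrix.map_mul, transpose_map, hPmap]
    simpa using hQA 1
  obtain ⟨σ, hσ⟩ := exists_permMatrix_eq hPP hPe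
  exact ⟨σ, by rw [hσ, hPA]⟩

theorem exists_polynomial_coeff_eq {R : Type*} [CommRing R] {m : ℕ} (y : Fin m → R) :
    ∃ f : Polynomial R, f.degree < m ∧ ∀ j : Fin m, f.coeff j = y j := by
  refine ⟨((Polynomial.degreeLTEquiv R m).symm y).1,
    Polynomial.mem_degreeLT.1 ((Polynomial.degreeLTEquiv R m).symm y).2, fun j => ?_⟩
  exact congrFun ((Polynomial.degreeLTEquiv R m).apply_symm_apply y) j

theorem walkMatrix_mulVec_coeff {n : ℕ} {R : Type*} [CommRing R] (A : Matrix (Fin n) (Fin n) R)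
    {f : Polynomial R} (hf : f.degree < n) :
    walkMatrix A *ᵥ (fun j => f.coeff j) = Polynomial.aeval A f *ᵥ 1 := by
  rcases Nat.eq_zero_or_pos n with rfl | hn
  · exact Subsingleton.elim _ _
  have hf' : f.natDegree < n := by
    rcases eq_or_ne f 0 with rfl | h0
    · simpa using hn
    · exact (Polynomial.natDegree_lt_iff_degree_lt h0).2 hf
  rw [Polynomial.aeval_eq_sum_range' hf',
    walkMatrix_mulVec_apply, sum_mulVec, Finset.sum_range]
  exact Finset.sum_congr rfl fun j _ => (smul_mulVec _ _ _).symm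

theorem aeval_map_mulVec_one {n R S : Type*} [Fintype n] [DecidableEq n] [CommRing R]
    [CommRing S] (φ : R →+* S) (A : Matrix n n R) (f : Polynomial R) :
    Polynomial.aeval (A.map φ) (f.map φ) *ᵥ 1 = φ ∘ (Polynomial.aeval A f *ᵥ 1) := by
  have h : Polynomial.aeval (A.map φ) (f.map φ) = (Polynomial.aeval A f).map φ := by
    rw [← RingHom.mapMatrix_apply, ← RingHom.mapMatrix_apply, Polynomial.aeval_def,
      Polynomial.aeval_def, Polynomial.eval₂_map, Polynomial.hom_eval₂]
    congr 1
    ext r i j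
    by_cases hij : i = j <;> simp [hij, Matrix.algebraMap_matrix_apply]
  ext i
  rw [h, Function.comp_apply, RingHom.map_mulVec]
  congr 2
  ext
  simp

theorem aeval_mod_mulVec {n F : Type*} [Fintype n] [DecidableEq n] [Field F]
    {A : Matrix n n F} {x : n → F} {z : Polynomial F} (hz : Polynomial.aeval A z *ᵥ x = 0)
    (g : Polynomial F) : Polynomial.aeval A (g % z) *ᵥ x = Polynomial.aeval A g *ᵥ x := by
  conv_rhs => rw [← EuclideanDomain.mod_add_div g z, mul_comm z, map_add, map_mul, add_mulVec,
    ← mulVec_mulVec, hz, mulVec_zero, add_zero]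

theorem exists_map_eq_and_degree_eq {R S : Type*} [CommRing R] [CommRing S] {φ : R →+* S}
    (hφ : Function.Surjective φ) (g : Polynomial S) :
    ∃ G : Polynomial R, G.map φ = g ∧ G.degree = g.degree :=
  Polynomial.exists_degree_eq_of_mem_lifts ((Polynomial.mem_lifts g).2 (Polynomial.map_surjective φ hφ g))

theorem dvd_of_not_sq_dvd_det_walkMatrix {n : ℕ} {A : Matrix (Fin n) (Fin n) ℤ} (hA : Aᵀ = A)
    {p : ℕ} (hp : p.Prime) (hdet : ¬ (p : ℤ) ^ 2 ∣ (walkMatrix A).det) {u : Fin n → ℤ}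
    (hu : ∀ k, (p : ℤ) ∣ u ⬝ᵥ (A ^ k *ᵥ 1)) (huu : ∀ k, (p : ℤ) ^ 2 ∣ u ⬝ᵥ (A ^ k *ᵥ u))
    (i : Fin n) : (p : ℤ) ∣ u i := by
  by_contra hui
  have := Fact.mk hp
  have hpp : Prime (p : ℤ) := Nat.prime_iff_prime_int.1 hp
  let φ := Int.castRingHom (ZMod p)
  have hφ : ∀ z : ℤ, φ z = 0 ↔ (p : ℤ) ∣ z := fun z => ZMod.intCast_zmod_eq_zero_iff_dvd z p
  set W := walkMatrix A with hW
  have hex : ∀ j, ∃ c, (u ᵥ* W) j = p * c := fun j => hu j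
  choose r hr using hex
  have hr' : u ᵥ* W = (p : ℤ) • r := funext hr
  set W' := W.updateRow i r with hW'
  have hdetW' : u i * W.det = p * W'.det := by
    have h := det_updateRow_sum W i u
    rw [smul_eq_mul] at h
    have hsum : ∑ k, u k • W k = (p : ℤ) • r := by
      rw [← hr']
      ext j
      simp [vecMul, dotProduct]
    rw [← h, hsum, det_updateRow_smul]
  have hW'p : ¬ (p : ℤ) ∣ W'.det := by
    rintro ⟨c, hc⟩
    apply hdet
    have : (p : ℤ) ^ 2 ∣ u i * W.det := ⟨c, by rw [hdetW', hc]; ring⟩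
    exact (hpp.coprime_iff_not_dvd.2 hui).pow_left.dvd_of_dvd_mul_left this
  set a := A.map φ with ha
  set w := W.map φ with hw
  set w' := W'.map φ with hw'
  set v : Fin n → ZMod p := φ ∘ u with hv
  have hwa : walkMatrix a = w := walkMatrix_map φ A
  have hvi : v i ≠ 0 := by rwa [hv, Function.comp_apply, Ne, hφ]
  have hw'unit : IsUnit w'.det := by
    rw [hw', ← RingHom.mapMatrix_apply, ← RingHom.map_det]
    exact isUnit_iff_ne_zero.2 (by rwa [Ne, hφ])
  have hrow : ∀ k, k ≠ i → w' k = w k := by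
    intro k hk
    ext j
    simp [w', w, W', hk]
  have hvw : v ᵥ* w = 0 := by
    ext j
    have := RingHom.map_vecMul φ W u j
    rw [hr'] at this
    rw [hv, hw, ← this]
    simp [φ]
  have hvv : v ⬝ᵥ v = 0 := by
    have h0 := huu 0
    rw [pow_zero, one_mulVec] at h0
    rw [hv, ← RingHom.map_dotProduct, hφ]
    exact (dvd_pow_self _ two_ne_zero).trans h0
  have hker : ∀ x, x ᵥ* w = 0 → x = (x i / v i) • v := by
    intro x hx
    set x' := x - (x i / v i) • v with hx'
    have hx'i : x' i = 0 := by simp [hx', hvi]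
    have hx'w : x' ᵥ* w = 0 := by rw [hx', sub_vecMul, hx, smul_vecMul, hvw, smul_zero, sub_zero]
    have hx'w' : x' ᵥ* w' = 0 := by
      rw [← hx'w]
      ext j
      simp only [vecMul, dotProduct]
      refine Finset.sum_congr rfl fun k _ => ?_
      rcases eq_or_ne k i with rfl | hk
      · rw [hx'i, zero_mul, zero_mul]
      · rw [hrow k hk]
    have : x' = 0 := by
      have h := congrArg (· ᵥ* w'⁻¹) hx'w'
      simpa [vecMul_vecMul, mul_nonsing_inv _ hw'unit] using h
    exact sub_eq_zero.1 this
  have hgen : ∃ y, w *ᵥ y = v := by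
    refine ⟨w'⁻¹ *ᵥ v, ?_⟩
    set y := w'⁻¹ *ᵥ v with hy
    have hw'y : w' *ᵥ y = v := by rw [hy, mulVec_mulVec, mul_nonsing_inv _ hw'unit, one_mulVec]
    have hne : ∀ k, k ≠ i → (w *ᵥ y - v) k = 0 := by
      intro k hk
      rw [Pi.sub_apply, ← hw'y, mulVec, mulVec, hrow k hk, sub_self]
    have hdot : v ⬝ᵥ (w *ᵥ y - v) = 0 := by
      rw [dotProduct_sub, dotProduct_mulVec, hvw, hvv, zero_dotProduct, sub_zero]
    have hi : (w *ᵥ y - v) i = 0 := by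
      rw [dotProduct, Finset.sum_eq_single i (fun k _ hk => by rw [hne k hk, mul_zero])
        (by simp)] at hdot
      exact (mul_eq_zero.1 hdot).resolve_left hvi
    refine sub_eq_zero.1 (funext fun k => ?_)
    rcases eq_or_ne k i with rfl | hk
    · exact hi
    · exact hne k hk
  obtain ⟨y, hy⟩ := hgen
  obtain ⟨y₀, hy₀, hwy₀⟩ : ∃ y₀ ≠ 0, w *ᵥ y₀ = 0 := by
    rw [exists_mulVec_eq_zero_iff]
    rw [hw, ← RingHom.mapMatrix_apply, ← RingHom.map_det, hφ]
    exact (hpp.dvd_or_dvd ⟨W'.det, hdetW'⟩).resolve_left hui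
  obtain ⟨g₀, hg₀, hg₀y⟩ := exists_polynomial_coeff_eq y
  obtain ⟨z, hz, hzy⟩ := exists_polynomial_coeff_eq y₀
  have hz0 : z ≠ 0 := by
    rintro rfl
    exact hy₀ (funext fun j => by rw [← hzy]; simp)
  have hza : Polynomial.aeval a z *ᵥ 1 = 0 := by
    rw [← walkMatrix_mulVec_coeff a hz, hwa, ← hwy₀]
    congr 1
    exact funext hzy
  have hg₀a : Polynomial.aeval a g₀ *ᵥ 1 = v := by
    rw [← walkMatrix_mulVec_coeff a hg₀, hwa, ← hy]
    congr 1
    exact funext hg₀y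
  obtain ⟨c, hc⟩ : ∃ c : ℤ, a *ᵥ v = φ c • v := by
    obtain ⟨c, hc⟩ := ZMod.intCast_surjective ((a *ᵥ v) i / v i)
    refine ⟨c, ?_⟩
    rw [show φ c = (a *ᵥ v) i / v i from hc]
    apply hker
    ext j
    have h1 : ((a *ᵥ v) ᵥ* w) j = φ (u ⬝ᵥ (A ^ (j + 1 : ℕ) *ᵥ 1)) := by
      have h2 : a *ᵥ v = φ ∘ (A *ᵥ u) := funext fun k => (RingHom.map_mulVec φ A u k).symm
      rw [h2, hw, ← RingHom.map_vecMul, add_comm, ← pow_dotProduct_pow hA, pow_one]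
      rfl
    rw [h1]
    exact (hφ _).2 (hu _)
  obtain ⟨G, hG, hGdeg⟩ := exists_map_eq_and_degree_eq (φ := φ) ZMod.intCast_surjective (g₀ % z)
  have hGa : φ ∘ (Polynomial.aeval A G *ᵥ 1) = v := by
    rw [← aeval_map_mulVec_one, hG, aeval_mod_mulVec hza, hg₀a]
  set Z := (Polynomial.X - Polynomial.C c) * G with hZ
  have hZdeg : Z.degree < n := by
    have h1 : G.degree < z.degree := hGdeg ▸ EuclideanDomain.mod_lt g₀ hz0
    rcases eq_or_ne G 0 with h0 | h0
    · rw [hZ, h0, mul_zero, Polynomial.degree_zero]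
      exact WithBot.bot_lt_coe n
    · rw [hZ, Polynomial.degree_mul, Polynomial.degree_X_sub_C]
      rw [Polynomial.degree_eq_natDegree h0, Polynomial.degree_eq_natDegree hz0] at *
      norm_cast at *
      omega
  have hZne : Z.map φ ≠ 0 := by
    rw [hZ, Polynomial.map_mul, Polynomial.map_sub, Polynomial.map_X, Polynomial.map_C]
    refine mul_ne_zero (Polynomial.X_sub_C_ne_zero _) fun h0 => hvi ?_
    rw [← hGa, ← aeval_map_mulVec_one, h0, map_zero, zero_mulVec, Pi.zero_apply]
  set x := Polynomial.aeval A G *ᵥ 1 with hx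
  have hZx : Polynomial.aeval A Z *ᵥ 1 = A *ᵥ x - c • x := by
    rw [hZ, map_mul, ← mulVec_mulVec, map_sub, Polynomial.aeval_X, Polynomial.aeval_C, sub_mulVec,
      Algebra.algebraMap_eq_smul_one, smul_mulVec, one_mulVec]
  set ζ : Fin n → ℤ := fun j => Z.coeff j with hζ
  have hWζ : W *ᵥ ζ = A *ᵥ x - c • x := by
    rw [← hZx, ← walkMatrix_mulVec_coeff A hZdeg]
  have hrζ : (p : ℤ) ∣ r ⬝ᵥ ζ := by
    have h1 : ∃ t : Fin n → ℤ, ∀ k, x k = u k - p * t k := by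
      have : ∀ k, ∃ t, x k = u k - p * t := by
        intro k
        have h2 : φ (u k - x k) = 0 := by
          rw [map_sub, sub_eq_zero]
          exact (congrFun hGa k).symm
        obtain ⟨t, ht⟩ := (hφ _).1 h2
        exact ⟨t, by rw [← ht]; ring⟩
      choose t ht using this
      exact ⟨t, ht⟩
    obtain ⟨t, ht⟩ := h1
    have h2 : ∃ β : Fin n → ℤ, ∀ k, (A *ᵥ u - c • u) k = p * β k := by
      have : ∀ k, (p : ℤ) ∣ (A *ᵥ u - c • u) k := by
        intro k
        rw [← hφ, Pi.sub_apply, map_sub, RingHom.map_mulVec, Pi.smul_apply, smul_eq_mul, map_mul,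
          sub_eq_zero]
        exact congrFun hc k
      choose β hβ using this
      exact ⟨β, hβ⟩
    obtain ⟨β, hβ⟩ := h2
    have hx' : x = u - (p : ℤ) • t := funext ht
    have hβ' : A *ᵥ u - c • u = (p : ℤ) • β := funext hβ
    have h3 : (p : ℤ) * (r ⬝ᵥ ζ) =
        u ⬝ᵥ (A ^ 1 *ᵥ u) - c * (u ⬝ᵥ (A ^ 0 *ᵥ u)) - (p : ℤ) ^ 2 * (β ⬝ᵥ t) := by
      have h4 : u ⬝ᵥ (A *ᵥ x) = (A *ᵥ u) ⬝ᵥ x := by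
        rw [← transpose_mulVec_dotProduct, hA]
      have h5 : (p : ℤ) * (r ⬝ᵥ ζ) = (A *ᵥ u - c • u) ⬝ᵥ x := by
        rw [← smul_eq_mul, ← smul_dotProduct, ← hr', ← dotProduct_mulVec, hWζ, dotProduct_sub, h4,
          sub_dotProduct, dotProduct_smul, smul_dotProduct]
      rw [h5, hx', dotProduct_sub, pow_one, pow_zero, one_mulVec, dotProduct_smul]
      nth_rewrite 2 [hβ']
      rw [sub_dotProduct, smul_dotProduct, smul_dotProduct, dotProduct_comm (A *ᵥ u)]
      simp only [smul_eq_mul]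
      ring
    have h4 : (p : ℤ) * p ∣ p * (r ⬝ᵥ ζ) := by
      rw [h3, ← sq]
      exact dvd_sub (dvd_sub (huu 1) ((huu 0).mul_left c)) (dvd_mul_right _ _)
    exact (mul_dvd_mul_iff_left hpp.ne_zero).1 h4
  have hw'ζ : w' *ᵥ (φ ∘ ζ) = 0 := by
    ext k
    rcases eq_or_ne k i with rfl | hk
    · have h1 : w' k = φ ∘ r := by
        ext j
        simp [w', W']
      rw [mulVec, h1, ← RingHom.map_dotProduct, Pi.zero_apply]
      exact (hφ _).2 hrζ
    · rw [mulVec, hrow k hk]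
      have h1 := RingHom.map_mulVec φ W ζ k
      rw [hWζ, Pi.sub_apply, map_sub, RingHom.map_mulVec, hGa, Pi.smul_apply, smul_eq_mul,
        map_mul] at h1
      refine h1.symm.trans (sub_eq_zero.2 ?_)
      rw [← ha, hc, ← hGa]
      rfl
  have hζ0 : φ ∘ ζ = 0 := by
    have h := congrArg (w'⁻¹ *ᵥ ·) hw'ζ
    simpa [mulVec_mulVec, nonsing_inv_mul _ hw'unit] using h
  apply hZne
  ext j
  rw [Polynomial.coeff_map, Polynomial.coeff_zero]
  by_cases hj : j < n
  · exact congrFun hζ0 ⟨j, hj⟩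
  · rw [Polynomial.coeff_eq_zero_of_degree_lt, map_zero]
    exact hZdeg.trans_le (by exact_mod_cast not_lt.1 hj)

theorem sum_sum_eq_sum_diag_of_symm {ι R : Type*} [CommRing R] [CharP R 2] (s : Finset ι)
    {S : ι → ι → R} (hS : ∀ i j, S i j = S j i) :
    ∑ i ∈ s, ∑ j ∈ s, S i j = ∑ i ∈ s, S i i := by
  classical
  rw [← Finset.sum_product', ← Finset.diag_union_offDiag,
    Finset.sum_union (Finset.disjoint_diag_offDiag s), Finset.sum_diag, add_eq_left]
  refine Finset.sum_involution (fun x _ => x.swap) ?_ ?_ ?_ ?_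
  · intro x _
    rw [Prod.fst_swap, Prod.snd_swap, hS x.2, CharTwo.add_self_eq_zero]
  · intro x hx _ h
    exact (Finset.mem_offDiag.1 hx).2.2 (congrArg Prod.snd h)
  · intro x hx
    rw [Finset.mem_offDiag] at *
    exact ⟨hx.2.1, hx.1, hx.2.2.symm⟩
  · intro x _
    exact x.swap_swap

theorem two_dvd_walk_count {n : ℕ} {A : Matrix (Fin n) (Fin n) ℤ} (hA : Aᵀ = A)
    (hA0 : ∀ i, A i i = 0) (k : ℕ) (hk : k ≠ 0 ∨ Even n) :
    (2 : ℤ) ∣ 1 ⬝ᵥ (A ^ k *ᵥ 1) := by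
  induction k using Nat.strong_induction_on with
  | _ k ih =>
    rcases Nat.even_or_odd' k with ⟨m, rfl | rfl⟩
    · rcases eq_or_ne m 0 with rfl | hm
      · have hn : Even n := by simpa using hk
        simpa [dotProduct] using (Int.natCast_dvd_natCast.2 hn.two_dvd)
      · have h1 := ih m (by omega) (Or.inl hm)
        rw [two_mul, ← pow_dotProduct_pow hA]
        rw [show (2 : ℤ) = ((2 : ℕ) : ℤ) from rfl, ← ZMod.intCast_zmod_eq_zero_iff_dvd] at h1 ⊢
        rw [← h1]
        simp only [dotProduct, Int.cast_sum, Int.cast_mul]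
        refine Finset.sum_congr rfl fun i _ => ?_
        generalize (((A ^ m *ᵥ 1) i : ℤ) : ZMod 2) = t
        rw [Pi.one_apply, Int.cast_one]
        revert t
        decide
    · have h1 : 1 ⬝ᵥ (A ^ (2 * m + 1) *ᵥ 1) = (A ^ m *ᵥ 1) ⬝ᵥ (A *ᵥ (A ^ m *ᵥ 1)) := by
        rw [mulVec_mulVec, ← pow_succ', pow_dotProduct_pow hA]
        congr 3
        ring
      rw [h1]
      generalize A ^ m *ᵥ 1 = x
      rw [show (2 : ℤ) = ((2 : ℕ) : ℤ) from rfl, ← ZMod.intCast_zmod_eq_zero_iff_dvd]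
      simp only [dotProduct, mulVec, Int.cast_sum, Int.cast_mul, Finset.mul_sum]
      rw [sum_sum_eq_sum_diag_of_symm Finset.univ (S := fun i j =>
        (x i : ZMod 2) * ((A i j : ZMod 2) * (x j : ZMod 2)))]
      · simp [hA0]
      · intro i j
        rw [← hA, transpose_apply, hA]
        ring

/-- Pairwise and self-orthogonal vectors are linearly dependent as soon as there are more than
half the dimension of them. -/
theorem exists_mulVec_eq_zero_of_transpose_mul_eq_zero {m n F : Type*} [Fintype m] [Fintype n]
    [DecidableEq m] [Field F] {M : Matrix m n F} (hM : Mᵀ * M = 0)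
    (hcard : Fintype.card m < 2 * Fintype.card n) : ∃ y ≠ 0, M *ᵥ y = 0 := by
  by_contra! hne
  have hinj : Function.Injective M.mulVecLin := by
    rw [injective_iff_map_eq_zero]
    intro y hy
    by_contra h0
    exact hne y h0 hy
  have hrank : M.rank = Fintype.card n := by
    rw [Matrix.rank, LinearMap.finrank_range_of_inj hinj, Module.finrank_fintype_fun_eq_card]
  have := rank_add_rank_le_card_of_mul_eq_zero hM
  rw [rank_transpose, hrank] at this
  omega

theorem exists_aeval_mulVec_one_eq_zero_mod_two {n : ℕ} {A : Matrix (Fin n) (Fin n) ℤ}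
    (hA : Aᵀ = A) (hA0 : ∀ i, A i i = 0) :
    ∃ z : Polynomial (ZMod 2), z ≠ 0 ∧ z.natDegree ≤ (n + 1) / 2 ∧
      Polynomial.aeval (A.map (Int.castRingHom (ZMod 2))) z *ᵥ 1 = 0 := by
  set φ := Int.castRingHom (ZMod 2)
  set a := A.map φ with ha
  have hapow : ∀ k, a ^ k *ᵥ 1 = φ ∘ (A ^ k *ᵥ 1) := by
    intro k
    have := aeval_map_mulVec_one φ A (Polynomial.X ^ k)
    simpa using this
  let M : Matrix (Fin n) (Fin (n / 2 + 1)) (ZMod 2) :=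
    Matrix.of fun i j => (a ^ ((j : ℕ) + n % 2) *ᵥ 1) i
  have hM : Mᵀ * M = 0 := by
    ext i j
    change (a ^ ((i : ℕ) + n % 2) *ᵥ 1) ⬝ᵥ (a ^ ((j : ℕ) + n % 2) *ᵥ 1) = 0
    rw [hapow, hapow, ← RingHom.map_dotProduct, pow_dotProduct_pow hA]
    refine (ZMod.intCast_zmod_eq_zero_iff_dvd _ 2).2 (two_dvd_walk_count hA hA0 _ ?_)
    rcases Nat.even_or_odd n with h | h
    · exact Or.inr h
    · left
      have := Nat.odd_iff.1 h
      omega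
  obtain ⟨y, hy, hMy⟩ := exists_mulVec_eq_zero_of_transpose_mul_eq_zero hM (by
    simp only [Fintype.card_fin]
    omega)
  obtain ⟨f, hf, hfy⟩ := exists_polynomial_coeff_eq y
  have hf0 : f ≠ 0 := by
    rintro rfl
    exact hy (funext fun j => by rw [← hfy]; simp)
  have hf' := (Polynomial.natDegree_lt_iff_degree_lt hf0).2 hf
  refine ⟨f * Polynomial.X ^ (n % 2), mul_ne_zero hf0 (pow_ne_zero _ Polynomial.X_ne_zero), ?_, ?_⟩
  · rw [Polynomial.natDegree_mul hf0 (pow_ne_zero _ Polynomial.X_ne_zero),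
      Polynomial.natDegree_X_pow]
    omega
  · have hMy' : M *ᵥ y = ∑ j, y j • (a ^ ((j : ℕ) + n % 2) *ᵥ 1) := by
      ext i
      simp [M, mulVec, dotProduct, mul_comm]
    rw [map_mul, map_pow, Polynomial.aeval_X, Polynomial.aeval_eq_sum_range' hf', Finset.sum_mul,
      sum_mulVec, Finset.sum_range, ← hMy, hMy']
    refine Finset.sum_congr rfl fun j _ => ?_
    rw [hfy, smul_mul_assoc, ← pow_add, smul_mulVec]

theorem sum_range_ite_even {R : Type*} [CommRing R] (f : ℕ → R) (n : ℕ) :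
    ∑ j ∈ Finset.range n, (if Even j then f (j / 2) else 0) =
      ∑ i ∈ Finset.range ((n + 1) / 2), f i := by
  induction n with
  | zero => simp
  | succ n ih =>
    rw [Finset.sum_range_succ, ih]
    rcases Nat.even_or_odd' n with ⟨m, rfl | rfl⟩
    · rw [if_pos (even_two_mul m), show (2 * m + 1 + 1) / 2 = m + 1 by omega,
        show (2 * m + 1) / 2 = m by omega, show 2 * m / 2 = m by omega, Finset.sum_range_succ]
    · rw [if_neg (by simp), add_zero, show (2 * m + 1 + 1 + 1) / 2 = (2 * m + 1 + 1) / 2 by omega]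

/-- The Gram matrix of the walk-matrix, with the factor two of each column removed. -/
theorem exists_half_gram {n : ℕ} (hn : 0 < n) {A : Matrix (Fin n) (Fin n) ℤ} (hA : Aᵀ = A)
    (hA0 : ∀ i, A i i = 0) {c : ℤ} (hc : (walkMatrix A).det = 2 ^ (n / 2) * c) :
    ∃ X : Matrix (Fin n) (Fin n) ℤ, X.det = c ^ 2 ∧ (walkMatrix A)ᵀ * walkMatrix A *
      diagonal (fun j : Fin n => if (j : ℕ) = 0 then 2 ^ (n % 2) else 1) = (2 : ℤ) • X := by
  set d : Fin n → ℤ := fun j => if (j : ℕ) = 0 then 2 ^ (n % 2) else 1 with hd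
  have hex : ∀ i j : Fin n, (2 : ℤ) ∣ ((walkMatrix A)ᵀ * walkMatrix A * diagonal d) i j := by
    intro i j
    rw [mul_diagonal]
    change (2 : ℤ) ∣ ((A ^ (i : ℕ) *ᵥ 1) ⬝ᵥ (A ^ (j : ℕ) *ᵥ 1)) * d j
    rw [pow_dotProduct_pow hA]
    by_cases h : (i + j : ℕ) ≠ 0 ∨ Even n
    · exact (two_dvd_walk_count hA hA0 _ h).mul_right _
    · push Not at h
      refine Dvd.dvd.mul_left ?_ _
      rw [hd]
      simp only
      rw [if_pos (by omega), Nat.odd_iff.1 (Nat.not_even_iff_odd.1 h.2), pow_one]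
  choose X hX using hex
  have hX' : (walkMatrix A)ᵀ * walkMatrix A * diagonal d = (2 : ℤ) • Matrix.of X := by
    ext i j
    exact hX i j
  refine ⟨Matrix.of X, ?_, hX'⟩
  have hdet := congrArg det hX'
  have hprod : ∏ j, d j = 2 ^ (n % 2) := by
    rw [Finset.prod_eq_single (⟨0, hn⟩ : Fin n)]
    · simp [hd]
    · intro j _ hj
      simp only [hd]
      rw [if_neg fun h => hj (Fin.ext h)]
    · simp
  rw [det_mul, det_mul, det_transpose, hc, det_diagonal, hprod, det_smul, Fintype.card_fin] at hdet
  have h2 : (2 : ℤ) ^ n = 2 ^ (n / 2) * 2 ^ (n / 2) * 2 ^ (n % 2) := by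
    rw [← pow_add, ← pow_add]
    congr 1
    omega
  apply mul_left_cancel₀ (pow_ne_zero n (two_ne_zero (α := ℤ)))
  rw [← hdet, h2]
  ring

theorem two_dvd_of_two_dvd_mulVec {m : Type*} [Fintype m] [DecidableEq m] {X : Matrix m m ℤ}
    (hX : Odd X.det) {v : m → ℤ} (hv : ∀ i, 2 ∣ (X *ᵥ v) i) (i : m) : 2 ∣ v i := by
  have h : X.adjugate *ᵥ (X *ᵥ v) = X.det • v := by
    rw [mulVec_mulVec, adjugate_mul, smul_mulVec, one_mulVec]
  have h1 : 2 ∣ X.det * v i := by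
    rw [← smul_eq_mul, ← Pi.smul_apply, ← h]
    exact Finset.dvd_sum fun j _ => (hv j).mul_left _
  exact (Int.prime_two.dvd_or_dvd h1).resolve_left (by
    rwa [← even_iff_two_dvd, Int.not_even_iff_odd])

/-- A vector orthogonal modulo two to all `A ^ k e` is modulo two a combination of the first half
of them. -/
theorem exists_aeval_mulVec_one_add_two_smul {n : ℕ} (hn : 0 < n) {A : Matrix (Fin n) (Fin n) ℤ}
    (hA : Aᵀ = A) (hA0 : ∀ i, A i i = 0) {c : ℤ} (hc : Odd c)
    (hdet : (walkMatrix A).det = 2 ^ (n / 2) * c) {u : Fin n → ℤ}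
    (hu : ∀ k, (2 : ℤ) ∣ u ⬝ᵥ (A ^ k *ᵥ 1)) :
    ∃ (G : Polynomial ℤ) (β : Fin n → ℤ), G.degree < ((n + 1) / 2 : ℕ) ∧
      u = Polynomial.aeval A G *ᵥ 1 + (2 : ℤ) • β := by
  obtain ⟨X, hX, hgram⟩ := exists_half_gram hn hA hA0 hdet
  obtain ⟨z, hz0, hzdeg, hz⟩ := exists_aeval_mulVec_one_eq_zero_mod_two hA hA0
  set φ := Int.castRingHom (ZMod 2)
  have hφ : ∀ z : ℤ, φ z = 0 ↔ 2 ∣ z := fun z => ZMod.intCast_zmod_eq_zero_iff_dvd z 2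
  set W := walkMatrix A with hW
  choose t ht using hu
  obtain ⟨y, hy⟩ : ∃ y, W *ᵥ y = X.det • u := by
    set D := diagonal (fun j : Fin n => if (j : ℕ) = 0 then (2 : ℤ) ^ (n % 2) else 1)
    refine ⟨D *ᵥ (X.adjugate *ᵥ fun j : Fin n => t j), sub_eq_zero.1 ?_⟩
    refine eq_zero_of_mulVec_eq_zero (M := Wᵀ) ?_ ?_
    · rw [det_transpose, hdet]
      refine mul_ne_zero (pow_ne_zero _ two_ne_zero) ?_
      rintro rfl
      exact absurd hc (by decide)
    · have htu : Wᵀ *ᵥ u = (2 : ℤ) • fun j : Fin n => t j := by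
        ext j
        rw [hW, walkMatrix_transpose_mulVec_apply, dotProduct_comm, ht]
        rfl
      rw [mulVec_sub, mulVec_smul, htu, mulVec_mulVec, mulVec_mulVec, hgram,
        smul_mulVec, mulVec_mulVec, mul_adjugate, smul_mulVec, one_mulVec, smul_comm, sub_self]
  have hφy : walkMatrix (A.map φ) *ᵥ (φ ∘ y) = φ ∘ u := by
    ext i
    have hodd : φ X.det = 1 := by
      rw [hX]
      exact (ZMod.intCast_eq_one_iff_odd).2 hc.pow
    rw [walkMatrix_map, ← RingHom.map_mulVec, ← hW, hy, Pi.smul_apply, smul_eq_mul, map_mul, hodd,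
      one_mul]
    rfl
  obtain ⟨g, hg, hgy⟩ := exists_polynomial_coeff_eq (φ ∘ y)
  obtain ⟨G, hG, hGdeg⟩ := exists_map_eq_and_degree_eq (φ := φ) ZMod.intCast_surjective (g % z)
  have hGu : φ ∘ (Polynomial.aeval A G *ᵥ 1) = φ ∘ u := by
    rw [← aeval_map_mulVec_one, hG, aeval_mod_mulVec hz, ← walkMatrix_mulVec_coeff _ hg, ← hφy]
    congr 1
    exact funext hgy
  have hβ : ∀ i, ∃ β, u i = (Polynomial.aeval A G *ᵥ 1) i + 2 * β := by
    intro i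
    obtain ⟨β, hβ⟩ := (hφ (u i - (Polynomial.aeval A G *ᵥ 1) i)).1 (by
      rw [map_sub, sub_eq_zero]
      exact (congrFun hGu i).symm)
    exact ⟨β, by rw [← hβ]; ring⟩
  choose β hβ using hβ
  refine ⟨G, β, ?_, funext hβ⟩
  rw [hGdeg]
  refine (EuclideanDomain.mod_lt g hz0).trans_le ?_
  rw [Polynomial.degree_eq_natDegree hz0]
  exact_mod_cast hzdeg

theorem two_dvd_of_det_walkMatrix {n : ℕ} {A : Matrix (Fin n) (Fin n) ℤ}
    (hA : Aᵀ = A) (hA0 : ∀ i, A i i = 0) {c : ℤ} (hc : Odd c)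
    (hdet : (walkMatrix A).det = 2 ^ (n / 2) * c) {u : Fin n → ℤ}
    (hu : ∀ k, (2 : ℤ) ∣ u ⬝ᵥ (A ^ k *ᵥ 1)) (huu : ∀ k, (2 : ℤ) ^ 2 ∣ u ⬝ᵥ (A ^ k *ᵥ u))
    (i : Fin n) : (2 : ℤ) ∣ u i := by
  have hn : 0 < n := i.pos
  obtain ⟨X, hX, hgram⟩ := exists_half_gram hn hA hA0 hdet
  obtain ⟨G, β, hG, hGu⟩ := exists_aeval_mulVec_one_add_two_smul hn hA hA0 hc hdet hu
  set x := Polynomial.aeval A G *ᵥ 1 with hx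
  set m := (n + 1) / 2 with hm
  set s : ℕ → ℤ := fun k => 1 ⬝ᵥ (A ^ k *ᵥ 1) with hs
  have hxsum : x = ∑ j ∈ Finset.range m, G.coeff j • (A ^ j *ᵥ 1) := by
    have hG' : G.natDegree < m := by
      rcases eq_or_ne G 0 with rfl | h0
      · rw [Polynomial.natDegree_zero]
        omega
      · exact (Polynomial.natDegree_lt_iff_degree_lt h0).2 hG
    rw [hx, Polynomial.aeval_eq_sum_range' hG', sum_mulVec]
    exact Finset.sum_congr rfl fun j _ => smul_mulVec _ _ _
  have hseven : ∀ k, k ≠ 0 → (2 : ℤ) ∣ s k := fun k hk =>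
    two_dvd_walk_count hA hA0 k (Or.inl hk)
  have hc0 : (2 : ℤ) ∣ G.coeff 0 * s 0 := by
    have h1 : x ⬝ᵥ 1 = ∑ j ∈ Finset.range m, G.coeff j * s j := by
      rw [hxsum, sum_dotProduct]
      exact Finset.sum_congr rfl fun j _ => by rw [smul_dotProduct, dotProduct_comm, smul_eq_mul]
    have h2 : (2 : ℤ) ∣ x ⬝ᵥ 1 := by
      have h3 := hu 0
      rw [pow_zero, one_mulVec, hGu, add_dotProduct, smul_dotProduct] at h3
      exact (dvd_add_left (dvd_mul_right _ _)).1 h3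
    have hm0 : 0 ∈ Finset.range m := Finset.mem_range.2 (by omega)
    rw [h1, ← Finset.add_sum_erase _ _ hm0] at h2
    exact (dvd_add_left (Finset.dvd_sum fun j hj =>
      (hseven j (Finset.ne_of_mem_erase hj)).mul_left _)).1 h2
  have hhalf : ∀ i j k, ∃ h, G.coeff i * G.coeff j * s (i + j + k) = 2 * h := by
    intro i j k
    by_cases h0 : i + j + k = 0
    · obtain ⟨rfl, rfl, rfl⟩ : i = 0 ∧ j = 0 ∧ k = 0 := by omega
      rw [mul_assoc]
      exact hc0.mul_left _
    · exact (hseven _ h0).mul_left _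
  choose h hh using hhalf
  have hxx : ∀ k, x ⬝ᵥ (A ^ k *ᵥ x) =
      2 * ∑ i ∈ Finset.range m, ∑ j ∈ Finset.range m, h i j k := by
    intro k
    rw [hxsum, sum_dotProduct, Finset.mul_sum]
    refine Finset.sum_congr rfl fun i _ => ?_
    rw [mulVec_sum, dotProduct_sum, Finset.mul_sum]
    refine Finset.sum_congr rfl fun j _ => ?_
    rw [← hh, mulVec_smul, dotProduct_smul, smul_dotProduct, mulVec_mulVec, ← pow_add,
      pow_dotProduct_pow hA, smul_eq_mul, smul_eq_mul, show i + (k + j) = i + j + k by omega]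
    ring
  have hxx4 : ∀ k, (2 : ℤ) * 2 ∣ x ⬝ᵥ (A ^ k *ᵥ x) := by
    intro k
    have h1 := huu k
    have h2 : u ⬝ᵥ (A ^ k *ᵥ u) =
        x ⬝ᵥ (A ^ k *ᵥ x) + 2 ^ 2 * (x ⬝ᵥ (A ^ k *ᵥ β) + β ⬝ᵥ (A ^ k *ᵥ β)) := by
      have h3 : β ⬝ᵥ (A ^ k *ᵥ x) = x ⬝ᵥ (A ^ k *ᵥ β) := by
        rw [dotProduct_comm, pow_mulVec_dotProduct hA]
      rw [hGu]
      simp only [add_dotProduct, mulVec_add, dotProduct_add, mulVec_smul, dotProduct_smul,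
        smul_dotProduct, h3, smul_eq_mul]
      ring
    rw [h2] at h1
    rw [← sq]
    exact (dvd_add_left (dvd_mul_right _ _)).1 h1
  have hdiag : ∀ k, (2 : ℤ) * 2 ∣ ∑ i ∈ Finset.range m, G.coeff i ^ 2 * s (2 * i + k) := by
    intro k
    have h1 : (2 : ℤ) ∣ ∑ i ∈ Finset.range m, ∑ j ∈ Finset.range m, h i j k :=
      (mul_dvd_mul_iff_left two_ne_zero).1 (hxx k ▸ hxx4 k)
    have h2 : (2 : ℤ) ∣ ∑ i ∈ Finset.range m, h i i k := by
      rw [show (2 : ℤ) = ((2 : ℕ) : ℤ) from rfl, ← ZMod.intCast_zmod_eq_zero_iff_dvd] at h1 ⊢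
      rw [← h1]
      push_cast
      refine (sum_sum_eq_sum_diag_of_symm _ (S := fun i j => ((h i j k : ℤ) : ZMod 2))
        fun i j => ?_).symm
      congr 1
      have : 2 * h i j k = 2 * h j i k := by
        rw [← hh, ← hh, add_comm i j]
        ring
      omega
    have h3 : ∑ i ∈ Finset.range m, G.coeff i ^ 2 * s (2 * i + k) =
        2 * ∑ i ∈ Finset.range m, h i i k := by
      rw [Finset.mul_sum]
      refine Finset.sum_congr rfl fun i _ => ?_
      rw [← hh, two_mul, sq]
    rw [h3]
    exact mul_dvd_mul_left _ h2
  set v : Fin n → ℤ := fun j => if Even (j : ℕ) then G.coeff (j / 2) ^ 2 else 0 with hv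
  have hgv : ∀ k : Fin n, (((walkMatrix A)ᵀ * walkMatrix A) *ᵥ v) k =
      ∑ i ∈ Finset.range m, G.coeff i ^ 2 * s (2 * i + k) := by
    intro k
    rw [hm, ← sum_range_ite_even (fun i => G.coeff i ^ 2 * s (2 * i + k)), Finset.sum_range]
    change ∑ j : Fin n, _ * _ = _
    refine Finset.sum_congr rfl fun j _ => ?_
    have h1 : ((walkMatrix A)ᵀ * walkMatrix A) k j = s (k + j) :=
      pow_dotProduct_pow hA k j 1 1
    rw [h1, show v j = if Even (j : ℕ) then G.coeff (j / 2) ^ 2 else 0 from rfl]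
    split_ifs with hj
    · rw [Nat.two_mul_div_two_of_even hj, add_comm (k : ℕ), mul_comm]
    · rw [mul_zero]
  obtain ⟨w, hw⟩ : ∃ w : Fin n → ℤ, v =
      diagonal (fun j : Fin n => if (j : ℕ) = 0 then (2 : ℤ) ^ (n % 2) else 1) *ᵥ w := by
    have hex : ∀ j : Fin n, ∃ w : ℤ, v j = (if (j : ℕ) = 0 then (2 : ℤ) ^ (n % 2) else 1) * w := by
      intro j
      split_ifs with hj
      · change (2 : ℤ) ^ (n % 2) ∣ v j
        rcases Nat.even_or_odd n with h0 | h0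
        · rw [Nat.even_iff.1 h0, pow_zero]
          exact one_dvd _
        · have hs0 : s 0 = n := by simp [hs, dotProduct]
          rw [hs0] at hc0
          have : (2 : ℤ) ∣ G.coeff 0 := (Int.prime_two.dvd_or_dvd hc0).resolve_right (by
            rw [← even_iff_two_dvd, Int.not_even_iff_odd]
            exact_mod_cast h0)
          rw [Nat.odd_iff.1 h0, pow_one]
          simp only [hv, hj]
          simpa using this.trans (dvd_pow_self _ two_ne_zero)
      · exact ⟨v j, (one_mul _).symm⟩
    choose w hw using hex
    exact ⟨w, funext fun j => by rw [mulVec_diagonal, hw]⟩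
  have hXw : ∀ k, (2 : ℤ) ∣ (X *ᵥ w) k := by
    intro k
    have h1 := hdiag (k : ℕ)
    rw [← hgv, hw, mulVec_mulVec, hgram, smul_mulVec] at h1
    exact (mul_dvd_mul_iff_left two_ne_zero).1 h1
  have hw2 := two_dvd_of_two_dvd_mulVec (hX ▸ hc.pow) hXw
  have hcoeff : ∀ j ∈ Finset.range m, (2 : ℤ) ∣ G.coeff j := by
    intro j hj
    have hjn : 2 * j < n := by
      have := Finset.mem_range.1 hj
      omega
    have h1 : (2 : ℤ) ∣ v ⟨2 * j, hjn⟩ := by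
      rw [hw, mulVec_diagonal]
      exact (hw2 _).mul_left _
    simp only [hv, even_two_mul, if_true] at h1
    rw [show 2 * j / 2 = j by omega] at h1
    exact Int.prime_two.dvd_of_dvd_pow h1
  rw [hGu, hxsum]
  refine dvd_add ?_ (dvd_mul_right _ _)
  rw [Finset.sum_apply]
  exact Finset.dvd_sum fun j hj => (hcoeff j hj).mul_right _

/-- Every graph in the family `F_n` is determined by its generalized
spectrum. -/
theorem stmt_0 (n : ℕ) (hn : 0 < n)
    (A : Matrix (Fin n) (Fin n) ℤ)
    (hA_symm : Aᵀ = A)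
    (hA_diag : ∀ i, A i i = 0)
    (hA_01 : ∀ i j, A i j = 0 ∨ A i j = 1)
    (W : Matrix (Fin n) (Fin n) ℤ)
    (hW : W = Matrix.of fun (i j : Fin n) => (A ^ (j : ℕ)).mulVec (fun _ => (1 : ℤ)) i)
    (hF : ∃ ε b : ℤ, (ε = 1 ∨ ε = -1) ∧ Odd b ∧ Squarefree b ∧
      W.det = ε * 2 ^ (n / 2) * b) :
    ∀ B : Matrix (Fin n) (Fin n) ℤ, Bᵀ = B → (∀ i, B i i = 0) →
      (∀ i j, B i j = 0 ∨ B i j = 1) →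
      A.charpoly = B.charpoly →
      ((Matrix.of fun _ _ => (1 : ℤ)) - 1 - A).charpoly
        = ((Matrix.of fun _ _ => (1 : ℤ)) - 1 - B).charpoly →
      ∃ σ : Equiv.Perm (Fin n), (σ.permMatrix ℤ)ᵀ * A * σ.permMatrix ℤ = B := by
  intro B hB _ _ hAB hAB'
  obtain ⟨ε, b, hε, hodd, hsq, hdet⟩ := hF
  change W = walkMatrix A at hW
  rw [hW] at hdet
  have hdet' : (walkMatrix A).det = 2 ^ (n / 2) * (ε * b) := by rw [hdet]; ring
  have hεu : IsUnit ε := Int.isUnit_iff.2 hε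
  have hoddε : Odd (ε * b) := by
    rcases hε with rfl | rfl
    · simpa using hodd
    · simpa using hodd
  refine exists_perm_of_walk_count_eq hA_symm hB (walk_count_eq hAB hAB') ?_ ?_
  · rw [hdet']
    exact mul_ne_zero (pow_ne_zero _ two_ne_zero) (mul_ne_zero hεu.ne_zero hsq.ne_zero)
  · intro p u hp hu huu
    rcases eq_or_ne p 2 with rfl | hp2
    · exact two_dvd_of_det_walkMatrix hA_symm hA_diag hoddε hdet' hu huu
    · refine dvd_of_not_sq_dvd_det_walkMatrix hA_symm hp (fun h => ?_) hu huu
      have hpp : Prime (p : ℤ) := Nat.prime_iff_prime_int.1 hp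
      have hcop : IsCoprime ((p : ℤ) ^ 2) (2 ^ (n / 2)) := by
        refine IsCoprime.pow (Nat.isCoprime_iff_coprime.2 ?_)
        exact (Nat.coprime_primes hp Nat.prime_two).2 hp2
      rw [hdet'] at h
      have h1 : (p : ℤ) * p ∣ b := by
        rw [← sq]
        exact hεu.dvd_mul_left.1 (hcop.dvd_of_dvd_mul_left h)
      exact hpp.not_isUnit (hsq _ h1)
end

section
/- Suppose det(W) ≠ 0, let Q belong to Q_G with level ℓ, and let p be an odd prime such that p divides det(W) but p² does not divide det(W). Then p does not divide ℓ. -/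
open Matrix

section Divisibility

variable {n : ℕ}

/-- If `m` divides `vM`, then `m` divides `(det M) v`. -/
lemma dvd_det_mul_of_dvd_vecMul {M : Matrix (Fin n) (Fin n) ℤ} {v : Fin n → ℤ} {m : ℤ}
    (h : ∀ j, m ∣ (v ᵥ* M) j) (i : Fin n) : m ∣ M.det * v i := by
  have key : (v ᵥ* M) ᵥ* M.adjugate = M.det • v := by
    rw [vecMul_vecMul, mul_adjugate, vecMul_smul, vecMul_one]
  have : M.det * v i = ∑ j, (v ᵥ* M) j * M.adjugate j i := by
    simpa [vecMul, dotProduct] using (congrFun key i).symm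
  rw [this]
  exact Finset.dvd_sum fun j _ => (h j).mul_right _

/-- If `p² ∤ det M`, a solution of `vM ≡ 0` modulo `p²` vanishes modulo `p`. -/
lemma dvd_of_sq_dvd_vecMul {M : Matrix (Fin n) (Fin n) ℤ} {v : Fin n → ℤ} {p : ℤ}
    (hp : Prime p) (hM : ¬ p ^ 2 ∣ M.det) (h : ∀ j, p ^ 2 ∣ (v ᵥ* M) j) (i : Fin n) :
    p ∣ v i := by
  by_contra hv
  exact hM (hp.pow_dvd_of_dvd_mul_right 2 hv (dvd_det_mul_of_dvd_vecMul h i))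

/-- If `p² ∤ det M`, the solutions of `vM ≡ 0` modulo `p` are pairwise proportional. -/
lemma dvd_minor_of_dvd_vecMul {M : Matrix (Fin n) (Fin n) ℤ} {z w : Fin n → ℤ} {p : ℤ}
    (hp : Prime p) (hM : ¬ p ^ 2 ∣ M.det) (hz : ∀ j, p ∣ (z ᵥ* M) j)
    (hw : ∀ j, p ∣ (w ᵥ* M) j) {i : Fin n} (hi : ¬ p ∣ z i) (j : Fin n) :
    p ∣ z i * w j - w i * z j := by
  choose t ht using hz
  have hdet : p * (M.updateRow i t).det = z i * M.det := by
    have h1 := det_updateRow_sum M i z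
    have h2 : ∑ k, z k • M k = p • t := by
      funext k
      rw [Pi.smul_apply, smul_eq_mul, ← ht k]
      simp [vecMul, dotProduct, Finset.sum_apply]
    rwa [h2, det_updateRow_smul, smul_eq_mul] at h1
  have hM' : ¬ p ∣ (M.updateRow i t).det := by
    rintro ⟨c, hc⟩
    refine hM (hp.pow_dvd_of_dvd_mul_left 2 hi ⟨c, ?_⟩)
    rw [← hdet, hc]
    ring
  refine (hp.dvd_or_dvd (dvd_det_mul_of_dvd_vecMul
    (v := fun k => z i * w k - w i * z k) (M := M.updateRow i t) (fun k => ?_) j)).resolve_left hM'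
  have : ((fun k => z i * w k - w i * z k) ᵥ* M.updateRow i t) k
      = z i * (w ᵥ* M) k - w i * (z ᵥ* M) k := by
    simp only [vecMul, dotProduct, Finset.mul_sum, ← Finset.sum_sub_distrib]
    refine Finset.sum_congr rfl fun l _ => ?_
    rcases eq_or_ne l i with rfl | hl
    · ring
    · rw [updateRow_ne hl]
      ring
  rw [this, ht k]
  exact dvd_sub ((hw k).mul_left _) ((dvd_mul_right _ _).mul_left _)

end Divisibility

/-- Over a field, let `z` be an isotropic eigenvector of a symmetric matrix `A`, orthogonal to `e`.
If every generalized eigenvector `x` with `(A - lam) x ∈ ⟨z⟩` that is orthogonal to `e` is a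
multiple of `z`, then `(A - lam) x ≡ b` modulo `⟨z⟩` is solvable with prescribed `x ⬝ᵥ e`,
for every `b` orthogonal to `z`. -/
lemma exists_bordered_solution {F : Type*} [Field F] {n : ℕ} {A : Matrix (Fin n) (Fin n) F}
    (hA : Aᵀ = A) {e z b : Fin n → F} {lam c : F} (hz0 : z ≠ 0) (hAz : A *ᵥ z = lam • z)
    (hzz : z ⬝ᵥ z = 0) (hze : z ⬝ᵥ e = 0)
    (hker : ∀ (x : Fin n → F) (m : F), A *ᵥ x = lam • x + m • z → x ⬝ᵥ e = 0 → ∃ a : F, x = a • z)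
    (hzb : z ⬝ᵥ b = 0) :
    ∃ (x : Fin n → F) (m : F), A *ᵥ x = lam • x + b + m • z ∧ x ⬝ᵥ e = c := by
  let T : ((Fin n → F) × F) →ₗ[F] ((Fin n → F) × F) :=
    { toFun := fun y => (A *ᵥ y.1 - lam • y.1 - y.2 • z, y.1 ⬝ᵥ e)
      map_add' := fun y y' => by
        ext1
        · simp only [Prod.fst_add, Prod.snd_add, mulVec_add, smul_add, add_smul]
          abel
        · simp [add_dotProduct]
      map_smul' := fun a y => by
        ext1
        · simp only [Prod.smul_fst, Prod.smul_snd, mulVec_smul, RingHom.id_apply, smul_sub,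
            smul_assoc]
          rw [smul_comm lam a]
        · simp [smul_dotProduct] }
  let f : ((Fin n → F) × F) →ₗ[F] F :=
    { toFun := fun y => z ⬝ᵥ y.1
      map_add' := fun y y' => by simp [dotProduct_add]
      map_smul' := fun a y => by simp [dotProduct_smul] }
  have hkerT : LinearMap.ker T = F ∙ ((z, 0) : (Fin n → F) × F) := by
    ext ⟨x, m⟩
    rw [LinearMap.mem_ker, Submodule.mem_span_singleton]
    constructor
    · intro h
      obtain ⟨h1, h2⟩ := Prod.mk.inj h
      have hx : A *ᵥ x = lam • x + m • z := by
        rwa [sub_sub, sub_eq_zero] at h1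
      obtain ⟨a, rfl⟩ := hker x m hx h2
      have hm : m • z = 0 := by
        rwa [mulVec_smul, hAz, smul_comm, left_eq_add] at hx
      exact ⟨a, by simp [(smul_eq_zero.mp hm).resolve_right hz0]⟩
    · rintro ⟨a, ha⟩
      obtain ⟨rfl, h2⟩ := Prod.mk.inj ha
      have hm : m = 0 := by simpa using h2.symm
      ext1
      · change A *ᵥ (a • z) - lam • (a • z) - m • z = 0
        rw [mulVec_smul, hAz, hm, smul_comm, sub_self, zero_smul, sub_zero]
      · change (a • z) ⬝ᵥ e = 0
        rw [smul_dotProduct, hze, smul_zero]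
  have hle : LinearMap.range T ≤ LinearMap.ker f := by
    rintro _ ⟨⟨x, m⟩, rfl⟩
    change z ⬝ᵥ (A *ᵥ x - lam • x - m • z) = 0
    have : z ⬝ᵥ A *ᵥ x = lam • (z ⬝ᵥ x) := by
      rw [dotProduct_mulVec, ← mulVec_transpose, hA, hAz, smul_dotProduct]
    rw [dotProduct_sub, dotProduct_sub, dotProduct_smul, dotProduct_smul, hzz, this]
    simp
  have hf : f ≠ 0 := by
    obtain ⟨i, hi⟩ := Function.ne_iff.mp hz0
    intro h
    have := LinearMap.congr_fun h (Pi.single i 1, 0)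
    exact hi (by simpa [f] using this)
  have heq : LinearMap.range T = LinearMap.ker f := by
    refine Submodule.eq_of_le_of_finrank_eq hle ?_
    have h1 := LinearMap.finrank_range_add_finrank_ker T
    have h2 := LinearMap.finrank_range_add_finrank_ker f
    have h3 : Module.finrank F (LinearMap.ker T) = 1 := by
      rw [hkerT]
      exact finrank_span_singleton (by simpa using hz0)
    have h4 : Module.finrank F (LinearMap.range f) = 1 := by
      rw [LinearMap.range_eq_top.mpr (LinearMap.surjective hf), finrank_top,
        Module.finrank_self]
    omega
  have hmem : ((b, c) : (Fin n → F) × F) ∈ LinearMap.range T := by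
    rw [heq]
    exact hzb
  obtain ⟨⟨x, m⟩, hx⟩ := hmem
  obtain ⟨h1, h2⟩ := Prod.mk.inj hx
  refine ⟨x, m, ?_, h2⟩
  rw [← h1]
  abel

lemma dotProduct_pow_succ_mulVec {R : Type*} [CommRing R] {n : ℕ} {A : Matrix (Fin n) (Fin n) R}
    (hA : Aᵀ = A) (x e : Fin n → R) (k : ℕ) :
    x ⬝ᵥ (A ^ (k + 1)) *ᵥ e = (A *ᵥ x) ⬝ᵥ (A ^ k) *ᵥ e := by
  rw [pow_succ', ← mulVec_mulVec, dotProduct_mulVec, ← mulVec_transpose, hA]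

/-- An integer vector `z`, nonzero modulo a prime `p`, that is orthogonal modulo `p` to all
`A ^ k e` and satisfies `zᵀ z ≡ zᵀ A z ≡ 0` modulo `p²` forces `p² ∣ det W`. -/
lemma sq_dvd_det_walkMatrix {n p : ℕ} (hp : p.Prime) {A : Matrix (Fin n) (Fin n) ℤ}
    (hA : Aᵀ = A) {e z : Fin n → ℤ} {i : Fin n} (hi : ¬ (p : ℤ) ∣ z i)
    (hz : ∀ k, (p : ℤ) ∣ z ⬝ᵥ (A ^ k) *ᵥ e) (hzz : (p : ℤ) ^ 2 ∣ z ⬝ᵥ z)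
    (hzAz : (p : ℤ) ^ 2 ∣ z ⬝ᵥ A *ᵥ z) :
    (p : ℤ) ^ 2 ∣ (Matrix.of fun i j : Fin n => ((A ^ (j : ℕ)) *ᵥ e) i).det := by
  set W : Matrix (Fin n) (Fin n) ℤ := Matrix.of fun i j : Fin n => ((A ^ (j : ℕ)) *ᵥ e) i with hW
  have hpZ : Prime (p : ℤ) := Nat.prime_iff_prime_int.mp hp
  have : Fact p.Prime := ⟨hp⟩
  by_contra hdet
  have hvW : ∀ (v : Fin n → ℤ) (j : Fin n), (v ᵥ* W) j = v ⬝ᵥ (A ^ (j : ℕ)) *ᵥ e :=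
    fun _ _ => rfl
  -- reduction modulo `p`
  let r : (Fin n → ℤ) → Fin n → ZMod p := fun v k => (v k : ZMod p)
  have hr : ∀ v w, ((v ⬝ᵥ w : ℤ) : ZMod p) = r v ⬝ᵥ r w := fun v w => by
    simp [dotProduct, r]
  let Ap : Matrix (Fin n) (Fin n) (ZMod p) := A.map (Int.cast : ℤ → ZMod p)
  have hrM : ∀ (M : Matrix (Fin n) (Fin n) ℤ) v,
      r (M *ᵥ v) = M.map (Int.cast : ℤ → ZMod p) *ᵥ r v := fun M v => by
    funext k
    simp [r, mulVec, dotProduct]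
  have hrA : ∀ v, r (A *ᵥ v) = Ap *ᵥ r v := hrM A
  have hrpow : ∀ k, r ((A ^ k) *ᵥ e) = (Ap ^ k) *ᵥ r e := fun k => by
    rw [hrM]
    exact congrArg (· *ᵥ r e) (map_pow (Int.castRingHom (ZMod p)).mapMatrix A k)
  have hr0 : ∀ v k, r v k = 0 ↔ (p : ℤ) ∣ v k := fun v k => ZMod.intCast_zmod_eq_zero_iff_dvd _ _
  have hsurj : ∀ x, ∃ v, r v = x := fun x => by
    choose v hv using fun k => ZMod.intCast_surjective (x k)
    exact ⟨v, funext hv⟩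
  have hAp : Apᵀ = Ap := by
    rw [← transpose_map, hA]
  have hzi : r z i ≠ 0 := fun h => hi ((hr0 z i).mp h)
  have hz0 : r z ≠ 0 := fun h => hzi (congrFun h i)
  have hdvd : ∀ v k, (p : ℤ) ∣ v ⬝ᵥ (A ^ k) *ᵥ e ↔ r v ⬝ᵥ (Ap ^ k) *ᵥ r e = 0 := fun v k => by
    rw [← hrpow, ← hr, ZMod.intCast_zmod_eq_zero_iff_dvd]
  have hzk : ∀ k, r z ⬝ᵥ (Ap ^ k) *ᵥ r e = 0 := fun k => (hdvd z k).mp (hz k)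
  have hprop : ∀ w : Fin n → ℤ, (∀ k, (p : ℤ) ∣ w ⬝ᵥ (A ^ k) *ᵥ e) →
      ∃ a : ZMod p, r w = a • r z := fun w hw => by
    refine ⟨(r z i)⁻¹ * r w i, funext fun j => ?_⟩
    have h := dvd_minor_of_dvd_vecMul (M := W) (z := z) (w := w) hpZ hdet (fun j => hz j)
      (fun j => hw j) hi j
    rw [← ZMod.intCast_zmod_eq_zero_iff_dvd] at h
    push_cast at h
    have h' : r z i * r w j = r w i * r z j := sub_eq_zero.mp h
    rw [Pi.smul_apply, smul_eq_mul, mul_assoc, ← h', inv_mul_cancel_left₀ hzi]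
  obtain ⟨a, ha⟩ := hprop (A *ᵥ z) fun k => by
    rw [← dotProduct_pow_succ_mulVec hA]
    exact hz (k + 1)
  obtain ⟨l, rfl⟩ := ZMod.intCast_surjective a
  have hAz : ∀ j, (p : ℤ) ∣ (A *ᵥ z - l • z) j := fun j => by
    rw [← hr0]
    have h := congrFun ha j
    simp only [r, Pi.smul_apply, smul_eq_mul] at h
    simp [r, h]
  choose b hb using hAz
  replace hb : A *ᵥ z = l • z + (p : ℤ) • b := by
    rw [← sub_eq_iff_eq_add']
    exact funext hb
  choose t ht using hz
  have hp0 : (p : ℤ) ≠ 0 := hpZ.ne_zero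
  have ht_succ : ∀ k, t (k + 1) = l * t k + b ⬝ᵥ (A ^ k) *ᵥ e := fun k => by
    apply mul_left_cancel₀ hp0
    rw [← ht, dotProduct_pow_succ_mulVec hA, hb, add_dotProduct, smul_dotProduct,
      smul_dotProduct, ht, smul_eq_mul, smul_eq_mul]
    ring
  have hzb : (p : ℤ) ∣ z ⬝ᵥ b := by
    rw [hb, dotProduct_add, dotProduct_smul, dotProduct_smul, smul_eq_mul, smul_eq_mul,
      dvd_add_right (hzz.mul_left l), sq] at hzAz
    exact Int.dvd_of_mul_dvd_mul_left hp0 hzAz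
  have hzz' : r z ⬝ᵥ r z = 0 := by
    rw [← hr, ZMod.intCast_zmod_eq_zero_iff_dvd]
    exact (dvd_pow_self _ two_ne_zero).trans hzz
  obtain ⟨x, m, hx, hxe⟩ := exists_bordered_solution (e := r e) (b := r b) (lam := (l : ZMod p))
    (c := (t 0 : ZMod p)) hAp hz0 (by rw [← hrA, ha]) hzz' (by simpa using hzk 0)
    (fun x m hx hxe => by
      obtain ⟨X, rfl⟩ := hsurj x
      refine hprop X fun k => (hdvd X k).mpr ?_
      induction k with
      | zero => simpa using hxe
      | succ k ih =>
        rw [dotProduct_pow_succ_mulVec hAp, hx, add_dotProduct, smul_dotProduct,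
          smul_dotProduct, ih, hzk, smul_zero, smul_zero, add_zero])
    (by rw [← hr, ZMod.intCast_zmod_eq_zero_iff_dvd]; exact hzb)
  have hxk : ∀ k, x ⬝ᵥ (Ap ^ k) *ᵥ r e = t k := fun k => by
    induction k with
    | zero => simpa using hxe
    | succ k ih =>
      rw [dotProduct_pow_succ_mulVec hAp, hx, add_dotProduct, add_dotProduct, smul_dotProduct,
        smul_dotProduct, ih, hzk, ht_succ, smul_zero, add_zero, ← hrpow, ← hr]
      push_cast
      rfl
  obtain ⟨X, rfl⟩ := hsurj x
  have hv := dvd_of_sq_dvd_vecMul (M := W) (v := z - (p : ℤ) • X) hpZ hdet (fun j => by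
    have hj : (p : ℤ) ∣ t j - X ⬝ᵥ (A ^ (j : ℕ)) *ᵥ e := by
      rw [← ZMod.intCast_zmod_eq_zero_iff_dvd, Int.cast_sub, hr, hrpow, hxk, sub_self]
    rw [hvW, sub_dotProduct, smul_dotProduct, ht, smul_eq_mul, ← mul_sub, sq]
    exact mul_dvd_mul_left _ hj) i
  refine hi ((dvd_sub_left (dvd_mul_right (p : ℤ) (X i))).mp ?_)
  simpa using hv

/-- If `p` is an odd prime dividing `det W` exactly once, then `p`
does not divide the level `ℓ` of any `Q ∈ Q_G`. -/
theorem stmt_4 (n : ℕ) (hn : 0 < n)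
    (A : Matrix (Fin n) (Fin n) ℤ)
    (hA_symm : Aᵀ = A)
    (hA_diag : ∀ i, A i i = 0)
    (hA_01 : ∀ i j, A i j = 0 ∨ A i j = 1)
    (W : Matrix (Fin n) (Fin n) ℤ)
    (hW : W = Matrix.of fun (i j : Fin n) => (A ^ (j : ℕ)).mulVec (fun _ => (1 : ℤ)) i)
    (hdet : W.det ≠ 0)
    (Q : Matrix (Fin n) (Fin n) ℚ)
    (hQ_orth : Qᵀ * Q = 1)
    (hQ_e : Q.mulVec (fun _ => (1 : ℚ)) = (fun _ => (1 : ℚ)))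
    (hQ_symm : (Qᵀ * A.map (Int.cast : ℤ → ℚ) * Q)ᵀ = Qᵀ * A.map (Int.cast : ℤ → ℚ) * Q)
    (hQ_diag : ∀ i, (Qᵀ * A.map (Int.cast : ℤ → ℚ) * Q) i i = 0)
    (hQ_01 : ∀ i j, (Qᵀ * A.map (Int.cast : ℤ → ℚ) * Q) i j = 0 ∨
      (Qᵀ * A.map (Int.cast : ℤ → ℚ) * Q) i j = 1)
    (ℓ : ℕ) (hℓ_pos : 0 < ℓ)
    (hℓ_int : ∀ i j, ∃ z : ℤ, (ℓ : ℚ) * Q i j = (z : ℚ))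
    (hℓ_min : ∀ m : ℕ, 0 < m → (∀ i j, ∃ z : ℤ, (m : ℚ) * Q i j = (z : ℚ)) → ℓ ≤ m)
    (p : ℕ) (hp : p.Prime) (hp_odd : Odd p)
    (hp_div : (p : ℤ) ∣ W.det) (hp2_ndiv : ¬ ((p : ℤ) ^ 2 ∣ W.det)) :
    ¬ (p ∣ ℓ) := by
  intro hpl
  obtain ⟨k, rfl⟩ := hpl
  choose N hN using hℓ_int
  -- some entry of `ℓ Q` is not divisible by `p`
  obtain ⟨i, j, hij⟩ : ∃ i j, ¬ (p : ℤ) ∣ N i j := by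
    by_contra! hall
    have hk : 0 < k := pos_of_mul_pos_right hℓ_pos p.zero_le
    have hle := hℓ_min k hk fun i j => by
      obtain ⟨c, hc⟩ := hall i j
      refine ⟨c, mul_left_cancel₀ (Nat.cast_ne_zero.mpr hp.ne_zero : (p : ℚ) ≠ 0) ?_⟩
      rw [← mul_assoc, ← Nat.cast_mul, hN, hc]
      push_cast
      rfl
    nlinarith [hp.two_le]
  have hB : ∃ B : Matrix (Fin n) (Fin n) ℤ,
      Qᵀ * A.map (Int.cast : ℤ → ℚ) * Q = B.map (Int.cast : ℤ → ℚ) := by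
    choose B hB using fun i j => show ∃ b : ℤ,
        (Qᵀ * A.map (Int.cast : ℤ → ℚ) * Q) i j = b from
      (hQ_01 i j).elim (fun h => ⟨0, by simpa using h⟩) (fun h => ⟨1, by simpa using h⟩)
    exact ⟨Matrix.of B, Matrix.ext hB⟩
  obtain ⟨B, hB⟩ := hB
  set L : ℕ := p * k with hL
  let M : Matrix (Fin n) (Fin n) ℤ := Matrix.of N
  have hM : M.map (Int.cast : ℤ → ℚ) = (L : ℚ) • Q := by
    ext a b
    exact (hN a b).symm
  have hinj : Function.Injective
      fun X : Matrix (Fin n) (Fin n) ℤ => X.map (Int.cast : ℤ → ℚ) :=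
    Matrix.map_injective Int.cast_injective
  have hmul : ∀ X Y : Matrix (Fin n) (Fin n) ℤ, (X * Y).map (Int.cast : ℤ → ℚ)
      = X.map (Int.cast : ℤ → ℚ) * Y.map (Int.cast : ℤ → ℚ) := fun X Y =>
    Matrix.map_mul (f := Int.castRingHom ℚ)
  have hMM : Mᵀ * M = (L : ℤ) ^ 2 • (1 : Matrix (Fin n) (Fin n) ℤ) := by
    apply hinj
    change (Mᵀ * M).map (Int.cast : ℤ → ℚ) = _
    rw [hmul, transpose_map, hM, transpose_smul, smul_mul_smul_comm, hQ_orth]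
    ext a b
    rcases eq_or_ne a b with rfl | hab
    · simp only [Matrix.smul_apply, Matrix.map_apply, one_apply_eq, smul_eq_mul]
      push_cast
      ring
    · simp only [Matrix.smul_apply, Matrix.map_apply, one_apply_ne hab, smul_eq_mul]
      simp
  have hAM : A * M = M * B := by
    apply hinj
    change (A * M).map (Int.cast : ℤ → ℚ) = (M * B).map (Int.cast : ℤ → ℚ)
    rw [hmul, hmul, hM, ← hB, Matrix.smul_mul, Matrix.mul_smul, Matrix.mul_assoc, ← Matrix.mul_assoc Q,
      mul_eq_one_comm.mp hQ_orth, Matrix.one_mul]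
  have hMe : M *ᵥ (fun _ => 1) = (L : ℤ) • (fun _ => 1 : Fin n → ℤ) := by
    funext a
    have h := congrFun hQ_e a
    simp only [mulVec, dotProduct, mul_one] at h
    have h' : ((∑ b, N a b : ℤ) : ℚ) = L := by
      push_cast
      simp only [← hN, ← Finset.mul_sum, h, mul_one]
    simp only [mulVec, dotProduct, mul_one, Pi.smul_apply, smul_eq_mul]
    exact_mod_cast h'
  have hMte : Mᵀ *ᵥ (fun _ => 1) = (L : ℤ) • (fun _ => 1 : Fin n → ℤ) := by
    have hL0 : (L : ℤ) ≠ 0 := by exact_mod_cast hℓ_pos.ne'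
    apply smul_right_injective _ hL0
    change (L : ℤ) • (Mᵀ *ᵥ (fun _ => 1)) = (L : ℤ) • (L : ℤ) • (fun _ => 1 : Fin n → ℤ)
    rw [← mulVec_smul, ← hMe, mulVec_mulVec, hMM, smul_mulVec, one_mulVec, hMe, smul_smul, sq]
  have hMtA : ∀ m, Mᵀ * A ^ m = Bᵀ ^ m * Mᵀ := fun m => by
    have h : SemiconjBy Mᵀ A Bᵀ := by
      have := congrArg transpose hAM
      rwa [transpose_mul, transpose_mul, hA_symm] at this
    exact h.pow_right m
  have hpL : (p : ℤ) ∣ L := ⟨k, by simp [hL]⟩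
  refine hp2_ndiv ?_
  rw [hW]
  refine sq_dvd_det_walkMatrix hp hA_symm (z := fun a => N a j) hij (fun m => ?_) ?_ ?_
  · change (p : ℤ) ∣ (Mᵀ *ᵥ (A ^ m) *ᵥ (fun _ => 1)) j
    rw [mulVec_mulVec, hMtA, ← mulVec_mulVec, hMte, mulVec_smul]
    exact hpL.mul_right _
  · change (p : ℤ) ^ 2 ∣ (Mᵀ * M) j j
    rw [hMM]
    exact (pow_dvd_pow_of_dvd hpL 2).mul_right _
  · change (p : ℤ) ^ 2 ∣ (Mᵀ * (A * M)) j j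
    rw [hAM, ← Matrix.mul_assoc, hMM, Matrix.smul_mul, Matrix.one_mul]
    exact (pow_dvd_pow_of_dvd hpL 2).mul_right _
end

section
/- Suppose G belongs to the family F_n and Q belongs to Q_G with level ℓ. Then ℓ = 2^m for some integer m ≥ 0. -/
open Matrix

open Polynomial in
/-- The walk-matrix applied to the coefficients of `f` is `f(A)e`. -/
theorem walk_mulVec_coeff {R : Type*} [CommRing R] {n : ℕ} (A : Matrix (Fin n) (Fin n) R)
    (f : R[X]) (hf : f.natDegree < n) :
    (Matrix.of fun (i j : Fin n) => ((A ^ (j : ℕ)) *ᵥ (fun _ => (1 : R))) i) *ᵥ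
      (fun i : Fin n => f.coeff i) = (aeval A f) *ᵥ (fun _ => (1 : R)) := by
  rw [aeval_eq_sum_range' hf, Matrix.sum_mulVec, ← Fin.sum_univ_eq_sum_range
    (fun i => (f.coeff i • A ^ i) *ᵥ (fun _ => (1 : R)))]
  ext i
  simp only [Finset.sum_apply, Matrix.smul_mulVec, Pi.smul_apply, smul_eq_mul]
  rw [Matrix.mulVec, dotProduct]
  exact Finset.sum_congr rfl fun j _ => mul_comm _ _

open Polynomial in
/-- Every vector is the coefficient vector of a polynomial of degree less than `n`. -/
theorem exists_polynomial_coeff_eq_s5 {R : Type*} [CommRing R] {n : ℕ} (hn : 0 < n) (d : Fin n → R) :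
    ∃ f : R[X], f.natDegree < n ∧ ∀ i : Fin n, f.coeff i = d i := by
  refine ⟨∑ j : Fin n, C (d j) * X ^ (j : ℕ), ?_, fun i => ?_⟩
  · refine lt_of_le_of_lt (natDegree_sum_le_of_forall_le (n := n - 1) _ _ fun j _ => ?_) (by omega)
    exact (natDegree_C_mul_X_pow_le _ _).trans (by omega)
  · simp [coeff_C_mul, coeff_X_pow, Fin.val_inj]

/-- If `W c ≡ 0` modulo `p ^ k` with `c ≢ 0` modulo the prime `p`, then `p ^ k ∣ det W`. -/
theorem pow_dvd_det_of_mulVec {n : ℕ} {p : ℤ} (hp : Prime p) (k : ℕ)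
    (W : Matrix (Fin n) (Fin n) ℤ) (c : Fin n → ℤ) (i : Fin n) (hi : ¬ p ∣ c i)
    (h : ∀ j, p ^ k ∣ (W *ᵥ c) j) : p ^ k ∣ W.det := by
  have h1 : (W.adjugate *ᵥ (W *ᵥ c)) i = W.det * c i := by
    rw [Matrix.mulVec_mulVec, Matrix.adjugate_mul, Matrix.smul_mulVec, Matrix.one_mulVec]
    simp
  have h2 : p ^ k ∣ W.det * c i := by
    rw [← h1, Matrix.mulVec, dotProduct]
    exact Finset.dvd_sum fun j _ => Dvd.dvd.mul_left (h j) _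
  exact hp.pow_dvd_of_dvd_mul_right k hi h2

/-- If `p² ∤ det W`, the left kernel of `W` modulo `p` is at most one-dimensional. -/
theorem dvd_minor_of_vecMul {n : ℕ} {p : ℤ} (hp : Prime p)
    (W : Matrix (Fin n) (Fin n) ℤ) (hW : ¬ p ^ 2 ∣ W.det) (u x : Fin n → ℤ) (i : Fin n)
    (hi : ¬ p ∣ u i) (hu : ∀ j, p ∣ (u ᵥ* W) j) (hx : ∀ j, p ∣ (x ᵥ* W) j) (j : Fin n) :
    p ∣ u i * x j - x i * u j := by
  by_contra hj
  apply hW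
  choose b hb using hu
  have h1 : p * (W.updateRow i b).det = u i * W.det := by
    have h := Matrix.det_updateRow_sum W i u
    have h3 : (∑ k, u k • W k) = p • b := by
      ext l
      rw [Pi.smul_apply, smul_eq_mul, ← hb l]
      simp [Matrix.vecMul, dotProduct]
    rw [h3, Matrix.det_updateRow_smul] at h
    simpa using h
  set y : Fin n → ℤ := u i • x - x i • u with hy
  have hyi : y i = 0 := by simp [hy, mul_comm]
  have h2 : y ᵥ* (W.updateRow i b) = y ᵥ* W := by
    ext l
    simp only [Matrix.vecMul, dotProduct]
    refine Finset.sum_congr rfl fun k _ => ?_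
    by_cases hk : k = i
    · subst hk; simp [hyi]
    · rw [Matrix.updateRow_ne hk]
  have h3 : p ^ 1 ∣ (W.updateRow i b)ᵀ.det := by
    refine pow_dvd_det_of_mulVec hp 1 _ y j (by simpa [hy] using hj) fun l => ?_
    rw [Matrix.mulVec_transpose, h2, hy, Matrix.sub_vecMul, Matrix.smul_vecMul,
      Matrix.smul_vecMul, pow_one]
    exact dvd_sub (Dvd.dvd.mul_left (hx l) _) (Dvd.dvd.mul_left ⟨_, hb l⟩ _)
  rw [Matrix.det_transpose, pow_one] at h3
  refine hp.pow_dvd_of_dvd_mul_left 2 hi ?_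
  rw [← h1, pow_two]
  exact mul_dvd_mul_left p h3

/-- If `p² ∤ det W` and `u ≢ 0` lies in the left kernel of `W` modulo `p`, then every vector
orthogonal to `u` modulo `p` is in the image of `W` modulo `p`. -/
theorem exists_mulVec_add_of_dvd_dotProduct {n : ℕ} {p : ℕ} [Fact p.Prime]
    (W : Matrix (Fin n) (Fin n) ℤ) (hW : ¬ (p : ℤ) ^ 2 ∣ W.det) (u : Fin n → ℤ) (i : Fin n)
    (hi : ¬ (p : ℤ) ∣ u i) (hu : ∀ j, (p : ℤ) ∣ (u ᵥ* W) j) (y : Fin n → ℤ)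
    (hy : (p : ℤ) ∣ u ⬝ᵥ y) : ∃ d z : Fin n → ℤ, y = W *ᵥ d + (p : ℤ) • z := by
  have hp : Prime (p : ℤ) := Nat.prime_iff_prime_int.mp Fact.out
  let φ := Int.castRingHom (ZMod p)
  have key : φ ∘ y ∈ LinearMap.range (Matrix.mulVecLin (W.map φ)) := by
    by_contra hmem
    obtain ⟨f, hf, hle⟩ := Submodule.exists_le_ker_of_notMem hmem
    obtain ⟨z, hz⟩ : ∃ z : Fin n → ℤ, ∀ k, φ (z k) = f (Pi.single k 1) := by
      choose z hz using fun k => ZMod.intCast_surjective (f (Pi.single k 1))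
      exact ⟨z, hz⟩
    have hfz : ∀ v : Fin n → ZMod p, f v = ∑ k, v k * φ (z k) := by
      intro v
      conv_lhs => rw [pi_eq_sum_univ' v, map_sum]
      exact Finset.sum_congr rfl fun k _ => by rw [map_smul, hz, smul_eq_mul]
    have hzW : ∀ j, (p : ℤ) ∣ (z ᵥ* W) j := by
      intro j
      have h0 : f (W.map φ *ᵥ Pi.single j 1) = 0 :=
        hle ⟨Pi.single j 1, rfl⟩
      rw [hfz] at h0
      rw [← ZMod.intCast_zmod_eq_zero_iff_dvd]
      simp only [Matrix.vecMul, dotProduct, Int.cast_sum, Int.cast_mul]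
      rw [← h0]
      exact Finset.sum_congr rfl fun k _ => by simp [φ, mul_comm]
    apply hf
    have h1 : ∀ k, (u i : ZMod p) * z k = z i * u k := by
      intro k
      have := dvd_minor_of_vecMul hp W hW u z i hi hu hzW k
      rw [← ZMod.intCast_zmod_eq_zero_iff_dvd] at this
      push_cast at this
      exact sub_eq_zero.mp this
    have h2 : (u i : ZMod p) ≠ 0 := by
      rwa [Ne, ZMod.intCast_zmod_eq_zero_iff_dvd]
    have h3 : (∑ k, (u k : ZMod p) * y k) = 0 := by
      rw [← ZMod.intCast_zmod_eq_zero_iff_dvd] at hy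
      simpa [dotProduct] using hy
    refine (mul_eq_zero.mp (?_ : (u i : ZMod p) * f (φ ∘ y) = 0)).resolve_left h2
    rw [hfz, Finset.mul_sum]
    calc _ = ∑ k, (z i : ZMod p) * (u k * y k) := Finset.sum_congr rfl fun k _ => by
            simp only [φ, Function.comp, Int.coe_castRingHom]
            linear_combination (y k : ZMod p) * h1 k
      _ = 0 := by rw [← Finset.mul_sum, h3, mul_zero]
  obtain ⟨d', hd'⟩ := key
  choose d hd using fun k => ZMod.intCast_surjective (d' k)
  have h4 : ∀ k, (p : ℤ) ∣ y k - (W *ᵥ d) k := by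
    intro k
    rw [← ZMod.intCast_zmod_eq_zero_iff_dvd, Int.cast_sub, sub_eq_zero]
    have h5 := congrFun hd' k
    simp only [Matrix.mulVecLin_apply, Function.comp, φ, Int.coe_castRingHom] at h5
    rw [← h5]
    simp [Matrix.mulVec, dotProduct, hd]
  choose z hz using h4
  refine ⟨d, z, ?_⟩
  ext k
  have := hz k
  simp only [Pi.add_apply, Pi.smul_apply, smul_eq_mul]
  linarith

open Polynomial in
/-- An isotropic vector `u` modulo `p²`, nonzero and in the left kernel of the walk-matrix
modulo `p`, forces `p²` to divide the determinant of the walk-matrix. -/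
theorem sq_dvd_det_walk {n p : ℕ} [Fact p.Prime] (A W : Matrix (Fin n) (Fin n) ℤ) (hA : Aᵀ = A)
    (hW : W = Matrix.of fun (i j : Fin n) => ((A ^ (j : ℕ)) *ᵥ (fun _ => (1 : ℤ))) i)
    (u : Fin n → ℤ) (i : Fin n) (hi : ¬ (p : ℤ) ∣ u i) (hu : ∀ j, (p : ℤ) ∣ (u ᵥ* W) j)
    (huu : (p : ℤ) ^ 2 ∣ u ⬝ᵥ u) (huAu : (p : ℤ) ^ 2 ∣ u ⬝ᵥ (A *ᵥ u)) :
    (p : ℤ) ^ 2 ∣ W.det := by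
  by_contra hdet
  have hp : Prime (p : ℤ) := Nat.prime_iff_prime_int.mp Fact.out
  have hp0 : (p : ℤ) ≠ 0 := hp.ne_zero
  have hn : 0 < n := i.pos
  have hpp : (p : ℤ) ∣ (p : ℤ) ^ 2 := dvd_pow_self _ two_ne_zero
  -- the columns of `W` span an `A`-invariant space modulo `p`
  obtain ⟨a, ha⟩ : ∃ a, (u ᵥ* W) = (p : ℤ) • a := by
    choose a ha using hu
    exact ⟨a, funext ha⟩
  have hpoly : ∀ f : ℤ[X], (p : ℤ) ∣ u ⬝ᵥ ((aeval A f) *ᵥ (fun _ => (1 : ℤ))) := by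
    intro f
    have hmon : A.charpoly.Monic := A.charpoly_monic
    have h1 : aeval A f = aeval A (f %ₘ A.charpoly) := by
      conv_lhs => rw [← modByMonic_add_div f A.charpoly]
      simp [Matrix.aeval_self_charpoly]
    have h2 : (f %ₘ A.charpoly).natDegree < n := by
      have := natDegree_modByMonic_lt f hmon (by
        intro h
        have := A.charpoly_natDegree_eq_dim
        rw [h] at this
        simp at this
        omega)
      simpa [A.charpoly_natDegree_eq_dim] using this
    rw [h1, ← walk_mulVec_coeff A _ h2, ← hW, Matrix.dotProduct_mulVec, ha, smul_dotProduct]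
    exact Dvd.intro _ rfl
  have hAu : ∀ j, (p : ℤ) ∣ ((A *ᵥ u) ᵥ* W) j := by
    intro j
    have h1 := hpoly (X ^ ((j : ℕ) + 1))
    have h2 : ((A *ᵥ u) ᵥ* W) j =
        u ⬝ᵥ ((aeval A (X ^ ((j : ℕ) + 1) : ℤ[X])) *ᵥ (fun _ => (1 : ℤ))) := by
      have h3 : ((A *ᵥ u) ᵥ* W) j = (A *ᵥ u) ⬝ᵥ ((A ^ (j : ℕ)) *ᵥ (fun _ => (1 : ℤ))) := by
        rw [hW]; rfl
      rw [h3, map_pow, aeval_X, pow_succ', ← Matrix.mulVec_mulVec, Matrix.dotProduct_mulVec u A,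
        ← Matrix.mulVec_transpose, hA]
    rwa [h2]
  -- `u` is an eigenvector modulo `p`
  obtain ⟨lam, w, hw⟩ : ∃ (lam : ℤ) (w : Fin n → ℤ), A *ᵥ u = lam • u + (p : ℤ) • w := by
    obtain ⟨s, t, hst⟩ : ∃ s t : ℤ, s * u i = 1 + p * t := by
      have hc : IsCoprime (p : ℤ) (u i) := (Prime.coprime_iff_not_dvd hp).mpr hi
      obtain ⟨x, y, hxy⟩ := hc
      exact ⟨y, -x, by linarith⟩
    have hm := dvd_minor_of_vecMul hp W hdet u (A *ᵥ u) i hi hu hAu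
    choose m hm using hm
    refine ⟨s * (A *ᵥ u) i, fun k => s * m k - t * (A *ᵥ u) k, ?_⟩
    ext k
    simp only [Pi.add_apply, Pi.smul_apply, smul_eq_mul]
    linear_combination s * hm k - (A *ᵥ u) k * hst
  have huw : (p : ℤ) ∣ u ⬝ᵥ w := by
    rw [hw, dotProduct_add, dotProduct_smul, dotProduct_smul, smul_eq_mul, smul_eq_mul] at huAu
    have h1 : (p : ℤ) ^ 2 ∣ p * (u ⬝ᵥ w) :=
      (dvd_add_right (Dvd.dvd.mul_left huu _)).mp huAu
    rw [pow_two] at h1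
    exact (mul_dvd_mul_iff_left hp0).mp h1
  let φ := Int.castRingHom (ZMod p)
  let one' : Fin n → ZMod p := fun _ => 1
  have hmapW : W.map φ =
      Matrix.of fun (i j : Fin n) => (((A.map φ) ^ (j : ℕ)) *ᵥ one') i := by
    ext k l
    rw [hW]
    have : (A.map φ) ^ (l : ℕ) = (A ^ (l : ℕ)).map φ := (map_pow φ.mapMatrix A l).symm
    rw [Matrix.of_apply, this]
    simp [Matrix.mulVec, dotProduct, one']
  have hdet0 : (W.map φ).det = 0 := by
    have h1 : (p : ℤ) ^ 1 ∣ Wᵀ.det := pow_dvd_det_of_mulVec hp 1 _ u i hi fun l => by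
      rw [Matrix.mulVec_transpose, pow_one]; exact hu l
    rw [Matrix.det_transpose, pow_one, ← ZMod.intCast_zmod_eq_zero_iff_dvd] at h1
    rw [← h1]
    exact (φ.map_det W).symm
  obtain ⟨c, hc0, hc⟩ := Matrix.exists_mulVec_eq_zero_iff.mpr hdet0
  obtain ⟨f, hfn, hfc⟩ := exists_polynomial_coeff_eq_s5 hn c
  have hf0 : f ≠ 0 := by
    rintro rfl
    exact hc0 (funext fun k => by simpa using (hfc k).symm)
  have hfA : aeval (A.map φ) f *ᵥ one' = 0 := by
    rw [← walk_mulVec_coeff _ f hfn, ← hmapW, ← hc]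
    congr 1
    exact funext hfc
  -- `u` is a polynomial in `A` of degree at most `n - 2` applied to `e`, modulo `p`
  obtain ⟨d, z, hdz⟩ := exists_mulVec_add_of_dvd_dotProduct W hdet u i hi hu u (hpp.trans huu)
  obtain ⟨q₀, hq₀n, hq₀⟩ := exists_polynomial_coeff_eq_s5 hn (fun k => φ (d k))
  have hq₀A : aeval (A.map φ) q₀ *ᵥ one' = fun k => φ (u k) := by
    rw [← walk_mulVec_coeff _ q₀ hq₀n, ← hmapW]
    ext k
    conv_rhs => rw [hdz]
    simp [Matrix.mulVec, dotProduct, hq₀, φ]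
  have hqA : aeval (A.map φ) (q₀ % f) *ᵥ one' = fun k => φ (u k) := by
    rw [← hq₀A]
    conv_rhs => rw [← EuclideanDomain.mod_add_div q₀ f, mul_comm f]
    rw [map_add, map_mul, Matrix.add_mulVec, ← Matrix.mulVec_mulVec, hfA, Matrix.mulVec_zero,
      add_zero]
  have hqne : q₀ % f ≠ 0 := by
    intro h
    rw [h, map_zero, Matrix.zero_mulVec] at hqA
    have := congrFun hqA i
    exact hi ((ZMod.intCast_zmod_eq_zero_iff_dvd _ _).mp this.symm)
  have hqdeg : (q₀ % f).natDegree < f.natDegree :=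
    natDegree_lt_natDegree hqne (EuclideanDomain.mod_lt q₀ hf0)
  obtain ⟨q, hqmap, hqd⟩ : ∃ q : ℤ[X], q.map φ = q₀ % f ∧ q.natDegree = (q₀ % f).natDegree := by
    have : (q₀ % f) ∈ lifts φ := (mem_lifts _).mpr
      (map_surjective φ ZMod.intCast_surjective _)
    exact exists_natDegree_eq_of_mem_lifts this
  obtain ⟨s, hs⟩ : ∃ s : Fin n → ℤ, aeval A q *ᵥ (fun _ => (1 : ℤ)) = u + (p : ℤ) • s := by
    have h1 : ∀ k, (p : ℤ) ∣ (aeval A q *ᵥ (fun _ => (1 : ℤ))) k - u k := by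
      intro k
      rw [← ZMod.intCast_zmod_eq_zero_iff_dvd, Int.cast_sub, sub_eq_zero]
      have h2 : aeval (A.map φ) (q.map φ) = (aeval A q).map φ := (map_aeval_eq_aeval_map (ψ := φ.mapMatrix) (RingHom.ext_int _ _) q A).symm
      have h3 := congrFun hqA k
      rw [← hqmap, h2] at h3
      refine Eq.trans ?_ h3
      simp [Matrix.mulVec, dotProduct, one', φ]
    choose s hs using h1
    refine ⟨s, funext fun k => ?_⟩
    have := hs k
    simp only [Pi.add_apply, Pi.smul_apply, smul_eq_mul]
    linarith
  -- hence `(A - λ) q(A) e` is a nontrivial relation between the columns of `W` modulo `p`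
  set F : ℤ[X] := (X - C lam) * q with hF
  have hFn : F.natDegree < n := by
    have h1 := natDegree_mul_le (p := X - C lam) (q := q)
    rw [natDegree_X_sub_C] at h1
    rw [← hF] at h1
    omega
  obtain ⟨k, hk⟩ : ∃ k : Fin n, ¬ (p : ℤ) ∣ F.coeff k := by
    by_contra! hall
    have h1 : F.map φ = 0 := by
      ext k
      rw [coeff_map, coeff_zero]
      by_cases hkn : k < n
      · exact (ZMod.intCast_zmod_eq_zero_iff_dvd _ _).mpr (hall ⟨k, hkn⟩)
      · rw [coeff_eq_zero_of_natDegree_lt (by omega), map_zero]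
    rw [hF, Polynomial.map_mul, hqmap, Polynomial.map_sub, map_X, map_C] at h1
    exact (mul_ne_zero (X_sub_C_ne_zero _) hqne) h1
  have hWF : W *ᵥ (fun k : Fin n => F.coeff k) = (p : ℤ) • (w + A *ᵥ s - lam • s) := by
    rw [hW, walk_mulVec_coeff A F hFn, hF, map_mul, ← Matrix.mulVec_mulVec, hs, map_sub, aeval_X,
      aeval_C, Matrix.sub_mulVec, Matrix.mulVec_add, hw, Matrix.mulVec_smul]
    have h1 : ∀ v : Fin n → ℤ, (algebraMap ℤ (Matrix (Fin n) (Fin n) ℤ) lam) *ᵥ v = lam • v := by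
      intro v
      rw [Algebra.algebraMap_eq_smul_one, Matrix.smul_mulVec, Matrix.one_mulVec]
    rw [h1]
    module
  have huy : (p : ℤ) ∣ u ⬝ᵥ (w + A *ᵥ s - lam • s) := by
    have h1 : u ⬝ᵥ (A *ᵥ s) = lam * (u ⬝ᵥ s) + p * (w ⬝ᵥ s) := by
      rw [Matrix.dotProduct_mulVec, ← Matrix.mulVec_transpose, hA, hw, add_dotProduct,
        smul_dotProduct, smul_dotProduct, smul_eq_mul, smul_eq_mul]
    rw [dotProduct_sub, dotProduct_add, h1, dotProduct_smul, smul_eq_mul]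
    obtain ⟨r, hr⟩ := huw
    exact ⟨r + w ⬝ᵥ s, by rw [hr]; ring⟩
  obtain ⟨d', z', hd'⟩ := exists_mulVec_add_of_dvd_dotProduct W hdet u i hi hu _ huy
  refine hdet (pow_dvd_det_of_mulVec hp 2 W ((fun k : Fin n => F.coeff k) - (p : ℤ) • d') k ?_ ?_)
  · intro h
    apply hk
    have := dvd_add h (Dvd.intro (d' k) rfl : (p : ℤ) ∣ p * d' k)
    simpa using this
  · intro j
    rw [Matrix.mulVec_sub, hWF, Matrix.mulVec_smul, hd']
    refine ⟨z' j, ?_⟩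
    simp only [Pi.sub_apply, Pi.add_apply, Pi.smul_apply, smul_eq_mul]
    ring

/-- If `G ∈ F_n` and `Q ∈ Q_G` has level `ℓ`, then `ℓ` is a power
of two. -/
theorem stmt_5 (n : ℕ) (hn : 0 < n)
    (A : Matrix (Fin n) (Fin n) ℤ)
    (hA_symm : Aᵀ = A)
    (hA_diag : ∀ i, A i i = 0)
    (hA_01 : ∀ i j, A i j = 0 ∨ A i j = 1)
    (W : Matrix (Fin n) (Fin n) ℤ)
    (hW : W = Matrix.of fun (i j : Fin n) => (A ^ (j : ℕ)).mulVec (fun _ => (1 : ℤ)) i)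
    (hF : ∃ ε b : ℤ, (ε = 1 ∨ ε = -1) ∧ Odd b ∧ Squarefree b ∧
      W.det = ε * 2 ^ (n / 2) * b)
    (Q : Matrix (Fin n) (Fin n) ℚ)
    (hQ_orth : Qᵀ * Q = 1)
    (hQ_e : Q.mulVec (fun _ => (1 : ℚ)) = (fun _ => (1 : ℚ)))
    (hQ_symm : (Qᵀ * A.map (Int.cast : ℤ → ℚ) * Q)ᵀ = Qᵀ * A.map (Int.cast : ℤ → ℚ) * Q)
    (hQ_diag : ∀ i, (Qᵀ * A.map (Int.cast : ℤ → ℚ) * Q) i i = 0)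
    (hQ_01 : ∀ i j, (Qᵀ * A.map (Int.cast : ℤ → ℚ) * Q) i j = 0 ∨
      (Qᵀ * A.map (Int.cast : ℤ → ℚ) * Q) i j = 1)
    (ℓ : ℕ) (hℓ_pos : 0 < ℓ)
    (hℓ_int : ∀ i j, ∃ z : ℤ, (ℓ : ℚ) * Q i j = (z : ℚ))
    (hℓ_min : ∀ m : ℕ, 0 < m → (∀ i j, ∃ z : ℤ, (m : ℚ) * Q i j = (z : ℚ)) → ℓ ≤ m) :
    ∃ m : ℕ, ℓ = 2 ^ m := by
  obtain ⟨ε, b, hε, hbodd, hbsq, hdet⟩ := hF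
  rcases Nat.eq_two_pow_or_exists_odd_prime_and_dvd ℓ with h | ⟨p, hp, ⟨r, hr⟩, hpodd⟩
  · exact h
  exfalso
  have : Fact p.Prime := ⟨hp⟩
  have hpZ : Prime (p : ℤ) := Nat.prime_iff_prime_int.mp hp
  have hpQ : (p : ℚ) ≠ 0 := by exact_mod_cast hp.ne_zero
  choose U hU using hℓ_int
  obtain ⟨i, j, hij⟩ : ∃ i j, ¬ (p : ℤ) ∣ U i j := by
    by_contra! hall
    have hr0 : 0 < r := Nat.pos_of_ne_zero (by rintro rfl; simp at hr; omega)
    have h1 := hℓ_min r hr0 fun i j => by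
      obtain ⟨z, hz⟩ := hall i j
      refine ⟨z, mul_left_cancel₀ hpQ ?_⟩
      have := hU i j
      rw [hz, hr] at this
      push_cast at this
      linarith
    have := hp.two_le
    nlinarith
  set AQ : Matrix (Fin n) (Fin n) ℚ := A.map (Int.cast : ℤ → ℚ) with hAQ
  set B : Matrix (Fin n) (Fin n) ℚ := Qᵀ * AQ * Q with hB
  have hQQ : Q * Qᵀ = 1 := mul_eq_one_comm.mp hQ_orth
  have hAB : ∀ k : ℕ, AQ ^ k * Q = Q * B ^ k := by
    intro k
    induction k with
    | zero => simp
    | succ k ih =>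
      rw [pow_succ, pow_succ, ← Matrix.mul_assoc Q, ← ih, hB, Matrix.mul_assoc, Matrix.mul_assoc,
        ← Matrix.mul_assoc Q, ← Matrix.mul_assoc Q, hQQ, Matrix.one_mul]
  have hBint : ∃ B' : Matrix (Fin n) (Fin n) ℤ, B = B'.map (Int.castRingHom ℚ) := by
    have h1 : ∀ i j, ∃ z : ℤ, B i j = z := fun i j => by
      rcases hQ_01 i j with h | h
      · exact ⟨0, by simp [h]⟩
      · exact ⟨1, by simp [h]⟩
    choose B' hB' using h1
    exact ⟨Matrix.of B', by ext i j; simp [hB']⟩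
  obtain ⟨B', hB'⟩ := hBint
  have hAsymm : AQᵀ = AQ := by rw [hAQ, ← Matrix.transpose_map, hA_symm]
  have heQ : (fun _ => (1 : ℚ)) ᵥ* Q = (fun _ => (1 : ℚ)) := by
    rw [← Matrix.mulVec_transpose]
    conv_lhs => rw [← hQ_e]
    rw [Matrix.mulVec_mulVec, hQ_orth, Matrix.one_mulVec]
  have hcol : (fun k => ((U k j : ℤ) : ℚ)) = (ℓ : ℚ) • (Q *ᵥ Pi.single j 1) := by
    ext k
    simp [← hU]
  have hpl : (p : ℤ) ∣ (ℓ : ℤ) := ⟨r, by exact_mod_cast hr⟩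
  have key : (p : ℤ) ^ 2 ∣ W.det := by
    refine sq_dvd_det_walk A W hA_symm hW (fun k => U k j) i hij (fun k => ?_) ?_ ?_
    · refine hpl.trans
        (Dvd.intro (((fun _ => (1 : ℤ)) ᵥ* (B' ^ (k : ℕ))) j) ?_)
      have hcast : (((fun k => U k j) ᵥ* W) k : ℚ) =
          (fun k => ((U k j : ℤ) : ℚ)) ⬝ᵥ ((AQ ^ (k : ℕ)) *ᵥ (fun _ => (1 : ℚ))) := by
        have : AQ ^ (k : ℕ) = (A ^ (k : ℕ)).map (Int.castRingHom ℚ) :=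
          (map_pow (Int.castRingHom ℚ).mapMatrix A k).symm
        rw [hW, this]
        simp [Matrix.vecMul, Matrix.mulVec, dotProduct]
      have hcast' : (((fun _ => (1 : ℤ)) ᵥ* (B' ^ (k : ℕ))) j : ℚ) =
          ((fun _ => (1 : ℚ)) ᵥ* (B ^ (k : ℕ))) j := by
        have : B ^ (k : ℕ) = (B' ^ (k : ℕ)).map (Int.castRingHom ℚ) := by
          rw [hB']; exact (map_pow (Int.castRingHom ℚ).mapMatrix B' k).symm
        rw [this]
        simp [Matrix.vecMul, dotProduct]
      have : ((ℓ : ℤ) * ((fun _ => (1 : ℤ)) ᵥ* (B' ^ (k : ℕ))) j : ℚ) =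
          (((fun k => U k j) ᵥ* W) k : ℚ) := by
        rw [hcast, hcast', hcol, smul_dotProduct, dotProduct_comm, ← Matrix.vecMul_transpose,
          Matrix.transpose_pow, hAsymm, ← Matrix.dotProduct_mulVec, Matrix.mulVec_mulVec, hAB,
          Matrix.dotProduct_mulVec, ← Matrix.vecMul_vecMul, heQ]
        simp
      exact_mod_cast this
    · refine (pow_dvd_pow_of_dvd hpl 2).trans (dvd_of_eq (Eq.symm ?_))
      have : (((fun k => U k j) ⬝ᵥ (fun k => U k j) : ℤ) : ℚ) = (ℓ : ℚ) ^ 2 := by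
        have h1 : (((fun k => U k j) ⬝ᵥ (fun k => U k j) : ℤ) : ℚ) =
            (fun k => ((U k j : ℤ) : ℚ)) ⬝ᵥ (fun k => ((U k j : ℤ) : ℚ)) := by
          simp [dotProduct]
        rw [h1, hcol, smul_dotProduct, dotProduct_smul, Matrix.dotProduct_mulVec,
          Matrix.vecMul_mulVec, hQ_orth]
        simp [pow_two]
      exact_mod_cast this
    · have : (((fun k => U k j) ⬝ᵥ (A *ᵥ (fun k => U k j)) : ℤ) : ℚ) = 0 := by
        have h1 : (((fun k => U k j) ⬝ᵥ (A *ᵥ (fun k => U k j)) : ℤ) : ℚ) =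
            (fun k => ((U k j : ℤ) : ℚ)) ⬝ᵥ (AQ *ᵥ (fun k => ((U k j : ℤ) : ℚ))) := by
          simp [dotProduct, Matrix.mulVec, hAQ]
        rw [h1, hcol, smul_dotProduct, Matrix.mulVec_smul, dotProduct_smul, Matrix.mulVec_mulVec,
          Matrix.dotProduct_mulVec, Matrix.vecMul_mulVec, ← Matrix.mul_assoc, ← hB]
        simp [hQ_diag]
      rw [Int.cast_eq_zero.mp this]
      exact dvd_zero _
  have hp2 : ¬ (p : ℤ) ∣ ε * 2 ^ (n / 2) := by
    intro h
    have h2 : (p : ℤ) ∣ 2 ^ (n / 2) := by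
      rcases hε with rfl | rfl <;> simpa using h
    have h3 : p ∣ 2 := by exact_mod_cast hpZ.dvd_of_dvd_pow h2
    rw [(Nat.prime_dvd_prime_iff_eq hp Nat.prime_two).mp h3] at hpodd
    exact absurd hpodd (by decide)
  rw [hdet] at key
  have hb2 := hpZ.pow_dvd_of_dvd_mul_left 2 hp2 key
  rw [pow_two] at hb2
  exact hpZ.not_isUnit (hbsq _ hb2)
end

section
/- Suppose n ≥ 2 and G belongs to the family F_n. Then rank₂(W) = ⌈n/2⌉, and there exist unimodular n×n integer matrices U, V (det ∈ {1, −1}) and an odd square-free integer b such that U W V = diag(d₁, …, dₙ), where dᵢ = 1 for 1 ≤ i ≤ ⌈n/2⌉, dᵢ = 2 for ⌈n/2⌉ < i ≤ n−1, and dₙ = 2b. -/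
open Matrix

/-- Two square integer matrices are unimodularly equivalent if one is obtained from the other by
multiplying on both sides with integer matrices of unit determinant. -/
def UnimodularEquiv {ι : Type*} [Fintype ι] [DecidableEq ι] (M N : Matrix ι ι ℤ) : Prop :=
  ∃ U V : Matrix ι ι ℤ, IsUnit U.det ∧ IsUnit V.det ∧ U * M * V = N

namespace UnimodularEquiv

variable {ι : Type*} [Fintype ι] [DecidableEq ι]

theorem refl (M : Matrix ι ι ℤ) : UnimodularEquiv M M :=
  ⟨1, 1, by simp, by simp, by simp⟩

theorem trans {M N P : Matrix ι ι ℤ} (h : UnimodularEquiv M N) (h' : UnimodularEquiv N P) :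
    UnimodularEquiv M P := by
  obtain ⟨U, V, hU, hV, rfl⟩ := h
  obtain ⟨U', V', hU', hV', rfl⟩ := h'
  refine ⟨U' * U, V * V', ?_, ?_, by simp only [Matrix.mul_assoc]⟩
  · rw [det_mul]; exact hU'.mul hU
  · rw [det_mul]; exact hV.mul hV'

theorem associated_det {M N : Matrix ι ι ℤ} (h : UnimodularEquiv M N) :
    Associated M.det N.det := by
  obtain ⟨U, V, hU, hV, rfl⟩ := h
  refine ⟨hU.unit * hV.unit, ?_⟩
  simp only [Units.val_mul, IsUnit.unit_spec, det_mul]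
  ring

theorem rank_map_eq {K : Type*} [Field K] {M N : Matrix ι ι ℤ} (h : UnimodularEquiv M N) :
    (M.map (Int.cast : ℤ → K)).rank = (N.map (Int.cast : ℤ → K)).rank := by
  obtain ⟨U, V, hU, hV, rfl⟩ := h
  have key : ∀ P : Matrix ι ι ℤ, IsUnit P.det → IsUnit (P.map (Int.cast : ℤ → K)).det := by
    intro P hP
    have := hP.map (Int.castRingHom K)
    rwa [RingHom.map_det] at this
  have hmul : ∀ P Q : Matrix ι ι ℤ,
      (P * Q).map (Int.cast : ℤ → K) = P.map Int.cast * Q.map Int.cast :=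
    fun P Q => Matrix.map_mul (f := Int.castRingHom K)
  rw [hmul, hmul, rank_mul_eq_left_of_isUnit_det _ _ (key V hV),
    rank_mul_eq_right_of_isUnit_det _ _ (key U hU)]

theorem diagonal_perm (a : ι → ℤ) (σ : Equiv.Perm ι) :
    UnimodularEquiv (diagonal a) (diagonal (a ∘ σ)) := by
  have hσ : ∀ τ : Equiv.Perm ι, IsUnit (τ.permMatrix ℤ).det := fun τ => by
    rw [det_permutation]
    exact (Equiv.Perm.sign τ).isUnit.map (Int.castRingHom ℤ)
  refine ⟨σ.permMatrix ℤ, (σ⁻¹).permMatrix ℤ, hσ _, hσ _, ?_⟩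
  ext i j
  simp [Equiv.Perm.permMatrix, PEquiv.toMatrix_toPEquiv_mul, PEquiv.mul_toMatrix_toPEquiv,
    diagonal_apply, Equiv.Perm.inv_def]

end UnimodularEquiv

/-- An integer matrix of determinant one acting on the coordinates `i` and `j` only. -/
theorem exists_mulVec_eq_update {ι : Type*} [Fintype ι] [DecidableEq ι] {i j : ι} (hij : i ≠ j)
    {α β γ δ : ℤ} (h : α * δ - β * γ = 1) :
    ∃ M : Matrix ι ι ℤ, IsUnit M.det ∧ ∀ f : ι → ℤ, M *ᵥ f =
      fun k => if k = i then α * f i + β * f j else if k = j then γ * f i + δ * f j else f k := by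
  let L (α β γ δ : ℤ) : (ι → ℤ) →ₗ[ℤ] (ι → ℤ) :=
    { toFun := fun f k =>
        if k = i then α * f i + β * f j else if k = j then γ * f i + δ * f j else f k
      map_add' := fun f g => by
        ext k; simp only [Pi.add_apply]; split_ifs <;> ring
      map_smul' := fun c f => by
        ext k; simp only [Pi.smul_apply, smul_eq_mul, RingHom.id_apply]; split_ifs <;> ring }
  have hL : L α β γ δ ∘ₗ L δ (-β) (-γ) α = LinearMap.id := by
    refine LinearMap.ext fun f => funext fun k => ?_
    simp only [L, LinearMap.comp_apply, LinearMap.coe_mk, AddHom.coe_mk, LinearMap.id_apply,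
      if_true, if_neg hij.symm]
    split_ifs with h1 h2
    · subst h1; linear_combination f k * h
    · subst h2; linear_combination f k * h
    · rfl
  refine ⟨LinearMap.toMatrix' (L α β γ δ), ?_, fun f => ?_⟩
  · refine IsUnit.of_mul_eq_one (LinearMap.toMatrix' (L δ (-β) (-γ) α)).det ?_
    rw [← det_mul, ← LinearMap.toMatrix'_comp, hL, LinearMap.toMatrix'_id, det_one]
  · rw [LinearMap.toMatrix'_mulVec]
    rfl

theorem unimodularEquiv_diagonal_merge {ι : Type*} [Fintype ι] [DecidableEq ι] {i j : ι}
    (hij : i ≠ j) (a : ι → ℤ) {p x z : ℤ} (hi : a i = p * x) (hj : a j = p * z)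
    (h : IsCoprime x z) :
    UnimodularEquiv (diagonal a)
      (diagonal fun k => if k = i then p else if k = j then p * x * z else a k) := by
  obtain ⟨s, t, hst⟩ := h
  obtain ⟨U, hU, hU'⟩ := exists_mulVec_eq_update hij (α := 1) (β := 1) (γ := -t * z) (δ := s * x)
    (by linear_combination hst)
  obtain ⟨V, hV, hV'⟩ := exists_mulVec_eq_update hij (α := s) (β := -z) (γ := t) (δ := x)
    (by linear_combination hst)
  refine ⟨U, V, hU, hV, ext_of_mulVec_single fun l => ?_⟩
  generalize (Pi.single l 1 : ι → ℤ) = f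
  rw [← mulVec_mulVec, ← mulVec_mulVec, hV', hU']
  funext k
  simp only [mulVec_diagonal, if_true, if_neg hij.symm, hi, hj]
  split_ifs with h1 h2
  · subst h1; linear_combination p * f k * hst
  · subst h2; linear_combination p * x * z * f k * hst
  · rfl

theorem unimodularEquiv_diagonal_prod {ι : Type*} [Fintype ι] [DecidableEq ι] (p c r : ι → ℤ)
    (l : ι) (hr : ∀ i, p i * r i = p l) (hcr : ∀ i, IsCoprime (c i) (r i))
    (hc : Pairwise fun i j => IsCoprime (c i) (c j)) (s : Finset ι) (hs : l ∉ s) :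
    UnimodularEquiv (diagonal fun k => p k * c k)
      (diagonal fun k => if k = l then p l * (c l * ∏ i ∈ s, c i)
        else if k ∈ s then p k else p k * c k) := by
  induction s using Finset.induction_on with
  | empty =>
    convert UnimodularEquiv.refl (diagonal fun k => p k * c k) using 3 with k
    by_cases hk : k = l <;> simp [hk]
  | insert i s his ih =>
    have hil : i ≠ l := fun h => hs (h ▸ Finset.mem_insert_self _ _)
    have hls : l ∉ s := fun h => hs (Finset.mem_insert_of_mem h)
    refine (ih hls).trans ?_
    have hcop : IsCoprime (c i) (r i * (c l * ∏ j ∈ s, c j)) :=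
      (hcr i).mul_right ((hc hil).mul_right
        (IsCoprime.prod_right fun j hj => hc fun h => his (h ▸ hj)))
    convert unimodularEquiv_diagonal_merge hil _ (p := p i) _ _ hcop using 3 with k
    · by_cases hki : k = i
      · subst hki; simp [hil]
      by_cases hkl : k = l
      · subst hkl
        simp only [if_true, if_neg hki, Finset.prod_insert his, ← hr i]
        ring
      · simp [hki, hkl]
    · simp [hil, his]
    · simp only [if_true, ← hr i]
      ring

theorem exists_unimodularEquiv_diagonal {ι : Type*} [Fintype ι] [DecidableEq ι]
    (M : Matrix ι ι ℤ) (hM : M.det ≠ 0) : ∃ a : ι → ℤ, UnimodularEquiv M (diagonal a) := by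
  have hinj : Function.Injective M.mulVecLin := mulVec_injective_of_det_ne_zero hM
  obtain ⟨b, a, b', hb⟩ := Submodule.exists_smith_normal_form_of_rank_eq (Pi.basisFun ℤ ι)
    (N := LinearMap.range M.mulVecLin) (LinearMap.finrank_range_of_inj hinj)
  let e₁ : (ι → ℤ) ≃ₗ[ℤ] (ι → ℤ) := b.equivFun
  let e₂ : (ι → ℤ) ≃ₗ[ℤ] (ι → ℤ) := b'.equivFun.symm.trans (LinearEquiv.ofInjective _ hinj).symm
  refine ⟨a, LinearMap.toMatrix' e₁.toLinearMap, LinearMap.toMatrix' e₂.toLinearMap, ?_, ?_, ?_⟩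
  · rw [LinearMap.det_toMatrix']; exact e₁.isUnit_det'
  · rw [LinearMap.det_toMatrix']; exact e₂.isUnit_det'
  · refine ext_of_mulVec_single fun i => ?_
    rw [← mulVec_mulVec, ← mulVec_mulVec, LinearMap.toMatrix'_mulVec, LinearMap.toMatrix'_mulVec]
    have h₂ : M *ᵥ (e₂ (Pi.single i 1)) = a i • b i := by
      have hb' : b' i = b'.equivFun.symm (Pi.single i 1) := by
        simp [Module.Basis.equivFun_symm_apply, Pi.single_apply]
      rw [← hb i, hb']
      exact congrArg Subtype.val ((LinearEquiv.ofInjective _ hinj).apply_symm_apply _)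
    simp only [LinearEquiv.coe_coe, h₂, e₁, map_smul]
    ext k
    simp [Finsupp.single_apply, Pi.single_apply, eq_comm]

theorem rank_add_le_rank_add_rank {K m n : Type*} [Field K] [Fintype m] [Fintype n]
    (M N : Matrix m n K) : (M + N).rank ≤ M.rank + N.rank := by
  unfold Matrix.rank
  refine le_trans (Submodule.finrank_mono ?_) (Submodule.finrank_add_le_finrank_add_finrank _ _)
  rintro _ ⟨v, rfl⟩
  rw [mulVecLin_add]
  exact Submodule.add_mem_sup ⟨v, rfl⟩ ⟨v, rfl⟩

/-- A symmetric matrix with zero diagonal over a ring of characteristic two is alternating. -/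
theorem dotProduct_mulVec_self_eq_zero {ι R : Type*} [Fintype ι] [CommRing R] [CharP R 2]
    (B : Matrix ι ι R) (hB : Bᵀ = B) (hB0 : ∀ i, B i i = 0) (x : ι → R) : x ⬝ᵥ B *ᵥ x = 0 := by
  have hsum : x ⬝ᵥ B *ᵥ x = ∑ q : ι × ι, x q.1 * (B q.1 q.2 * x q.2) := by
    simp [dotProduct, mulVec, Fintype.sum_prod_type, Finset.mul_sum]
  rw [hsum]
  refine Finset.sum_involution (fun q _ => q.swap) ?_ ?_ (by simp) (by simp)
  · rintro ⟨i, j⟩ -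
    have hs : B j i = B i j := congrFun (congrFun hB i) j
    simp only [Prod.swap, hs]
    rw [show x j * (B i j * x i) = x i * (B i j * x j) by ring]
    exact CharTwo.add_self_eq_zero _
  · rintro ⟨i, j⟩ - hne heq
    have : j = i := congrArg Prod.fst heq
    subst this
    simp [hB0] at hne

theorem pow_mulVec_dotProduct_pow_mulVec {ι R : Type*} [Fintype ι] [DecidableEq ι] [CommRing R]
    (B : Matrix ι ι R) (hB : Bᵀ = B) (x y : ι → R) (k l : ℕ) :
    (B ^ k *ᵥ x) ⬝ᵥ (B ^ l *ᵥ y) = x ⬝ᵥ (B ^ (k + l) *ᵥ y) := by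
  rw [dotProduct_comm, dotProduct_mulVec, ← mulVec_transpose, transpose_pow, hB, mulVec_mulVec,
    ← pow_add, dotProduct_comm]

theorem one_dotProduct_pow_mulVec_one {ι : Type*} [Fintype ι] [DecidableEq ι]
    (B : Matrix ι ι (ZMod 2)) (hB : Bᵀ = B) (hB0 : ∀ i, B i i = 0) (k : ℕ) (hk : 0 < k) :
    (1 : ι → ZMod 2) ⬝ᵥ (B ^ k *ᵥ 1) = 0 := by
  induction k using Nat.strong_induction_on with
  | _ k ih =>
    rcases Nat.even_or_odd' k with ⟨m, rfl | rfl⟩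
    · rw [two_mul, ← pow_mulVec_dotProduct_pow_mulVec B hB]
      have hsq : ∀ t : ZMod 2, t * t = 1 * t := by decide
      have : ∀ x : ι → ZMod 2, x ⬝ᵥ x = 1 ⬝ᵥ x := fun x =>
        Finset.sum_congr rfl fun i _ => hsq (x i)
      rw [this]
      exact ih m (by omega) (by omega)
    · rw [show 2 * m + 1 = m + (1 + m) by ring, ← pow_mulVec_dotProduct_pow_mulVec B hB,
        pow_add, pow_one, ← mulVec_mulVec]
      exact dotProduct_mulVec_self_eq_zero B hB hB0 _

theorem rank_walkMatrix_zmod_two_le {n : ℕ} (B : Matrix (Fin n) (Fin n) (ZMod 2)) (hB : Bᵀ = B)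
    (hB0 : ∀ i, B i i = 0) :
    2 * (Matrix.of fun (i j : Fin n) => (B ^ (j : ℕ) *ᵥ 1) i).rank ≤ n + 1 := by
  set W := Matrix.of fun (i j : Fin n) => (B ^ (j : ℕ) *ᵥ 1) i with hW
  let D : Matrix (Fin n) (Fin n) (ZMod 2) := diagonal fun j => if (j : ℕ) = 0 then 0 else 1
  let E : Matrix (Fin n) (Fin n) (ZMod 2) := diagonal fun j => if (j : ℕ) = 0 then 1 else 0
  have hDE : W * D + W * E = W := by
    rw [← Matrix.mul_add]
    convert Matrix.mul_one W
    ext i j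
    by_cases h : i = j
    · subst h; by_cases h0 : (i : ℕ) = 0 <;> simp [D, E, h0]
    · simp [D, E, h]
  have hE : (W * E).rank ≤ 1 := by
    refine (rank_mul_le_right _ _).trans ?_
    rw [rank_diagonal, Fintype.card_le_one_iff]
    rintro ⟨i, hi⟩ ⟨j, hj⟩
    simp only [ne_eq, ite_eq_right_iff, one_ne_zero, imp_false, not_not] at hi hj
    exact Subtype.ext (Fin.ext (hi.trans hj.symm))
  have h0 : (W * D)ᵀ * W = 0 := by
    ext i j
    simp only [mul_apply', Matrix.zero_apply]
    by_cases hi : (i : ℕ) = 0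
    · simp [dotProduct, transpose_apply, D, mul_diagonal, hi]
    · have : ((W * D)ᵀ i) ⬝ᵥ (fun k => W k j) = (B ^ (i : ℕ) *ᵥ 1) ⬝ᵥ (B ^ (j : ℕ) *ᵥ 1) := by
        simp [dotProduct, transpose_apply, D, mul_diagonal, hi, hW]
      rw [this, pow_mulVec_dotProduct_pow_mulVec B hB]
      exact one_dotProduct_pow_mulVec_one B hB hB0 _ (by omega)
  have h1 := rank_add_rank_le_card_of_mul_eq_zero h0
  rw [rank_transpose, Fintype.card_fin] at h1
  have h2 := rank_add_le_rank_add_rank (W * D) (W * E)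
  rw [hDE] at h2
  omega

/-- If `∏ aᵢ` is associated to `2 ^ m * b` with `b` odd and square-free and exactly `m ≥ 1` of the
`aᵢ` are even, then `diagonal a` is equivalent to the diagonal matrix with each `aᵢ` replaced by
its parity class in `{1, 2}` except for one even entry, which carries the whole odd part. -/
theorem unimodularEquiv_diagonal_of_squarefree {ι : Type*} [Fintype ι] [DecidableEq ι]
    (a : ι → ℤ) (b : ℤ) (hb : Odd b) (hsq : Squarefree b)
    (ha : Associated (∏ i, a i) (2 ^ (Finset.univ.filter fun i => Even (a i)).card * b))
    (l : ι) (hl : Even (a l)) :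
    ∃ b' : ℤ, Odd b' ∧ Squarefree b' ∧ UnimodularEquiv (diagonal a)
      (diagonal fun i => if i = l then 2 * b' else if Even (a i) then 2 else 1) := by
  let p : ι → ℤ := fun i => if Even (a i) then 2 else 1
  let r : ι → ℤ := fun i => if Even (a i) then 1 else 2
  have hp : ∀ i, ∃ c, a i = p i * c := fun i => by
    by_cases h : Even (a i)
    · obtain ⟨c, hc⟩ := h.two_dvd
      exact ⟨c, by simpa [p, h] using hc⟩
    · exact ⟨a i, by simp [p, h]⟩
  choose c hc using hp
  have hprod : Associated (∏ i, c i) b := by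
    have h1 : ∏ i, a i = 2 ^ (Finset.univ.filter fun i => Even (a i)).card * ∏ i, c i := by
      rw [Finset.prod_congr rfl fun i _ => hc i, Finset.prod_mul_distrib]
      simp [p, Finset.prod_ite]
    rw [h1] at ha
    exact ha.of_mul_left (Associated.refl _) (by positivity)
  have hcsq : Squarefree (∏ i, c i) := hprod.squarefree_iff.mpr hsq
  have hcodd : Odd (∏ i, c i) := by
    rw [← Int.not_even_iff_odd, even_iff_two_dvd, hprod.dvd_iff_dvd_right, ← even_iff_two_dvd,
      Int.not_even_iff_odd]
    exact hb
  have hci : ∀ i, Odd (c i) := fun i =>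
    Int.not_even_iff_odd.mp fun h => Int.not_even_iff_odd.mpr hcodd <|
      even_iff_two_dvd.mpr (h.two_dvd.trans (Finset.dvd_prod_of_mem c (Finset.mem_univ i)))
  have hcop : Pairwise fun i j => IsCoprime (c i) (c j) := by
    intro i j hij
    refine IsRelPrime.isCoprime (IsRelPrime.of_squarefree_mul (hcsq.squarefree_of_dvd ?_))
    rw [← Finset.prod_pair hij]
    exact Finset.prod_dvd_prod_of_subset _ _ _ (Finset.subset_univ _)
  refine ⟨∏ i, c i, hcodd, hcsq, ?_⟩
  have := unimodularEquiv_diagonal_prod p c r l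
    (fun i => by by_cases h : Even (a i) <;> simp [p, r, h, hl])
    (fun i => by
      by_cases h : Even (a i)
      · simpa [r, h] using isCoprime_one_right
      · simpa [r, h] using Int.isCoprime_two_right.mpr (hci i))
    hcop (Finset.univ.erase l) (Finset.notMem_erase _ _)
  convert this using 3 with i i
  · exact hc i
  · rw [Finset.mul_prod_erase _ _ (Finset.mem_univ l)]
    by_cases h : i = l
    · simp [h, p, hl]
    · simp [h, p]

theorem two_pow_card_even_dvd_prod {ι : Type*} [Fintype ι] (a : ι → ℤ) :
    2 ^ (Finset.univ.filter fun i => Even (a i)).card ∣ ∏ i, a i := by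
  rw [← Finset.prod_const]
  refine (Finset.prod_dvd_prod_of_dvd _ _ fun i hi => ?_).trans
    (Finset.prod_dvd_prod_of_subset _ _ _ (Finset.subset_univ _))
  exact (Finset.mem_filter.mp hi).2.two_dvd

theorem rank_map_diagonal_zmod_two {ι : Type*} [Fintype ι] [DecidableEq ι] (a : ι → ℤ) :
    ((diagonal a).map (Int.cast : ℤ → ZMod 2)).rank +
      (Finset.univ.filter fun i => Even (a i)).card = Fintype.card ι := by
  rw [diagonal_map Int.cast_zero, rank_diagonal, Fintype.card_subtype, add_comm]
  have := Finset.card_filter_add_card_filter_not (s := (Finset.univ : Finset ι))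
    (fun i => Even (a i))
  rw [Finset.card_univ] at this
  convert this using 5 with i
  simp [ZMod.intCast_eq_zero_iff_even]

theorem exists_perm_iff_of_card_eq {ι : Type*} [Fintype ι] (P Q : ι → Prop) [DecidablePred P]
    [DecidablePred Q] (h : (Finset.univ.filter P).card = (Finset.univ.filter Q).card) :
    ∃ σ : Equiv.Perm ι, ∀ i, Q (σ i) ↔ P i := by
  have h1 : Fintype.card {x // P x} = Fintype.card {x // Q x} := by
    simpa only [Fintype.card_subtype] using h
  obtain ⟨e⟩ := Fintype.card_eq.mp h1
  exact ⟨e.extendSubtype, fun i =>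
    ⟨fun hq => by_contra fun hp => e.extendSubtype_not_mem i hp hq, e.extendSubtype_mem i⟩⟩

/-- For `G ∈ F_n` (with `n ≥ 2`), `rank₂(W) = ⌈n/2⌉` and the Smith
normal form of `W` is `diag(1,…,1,2,…,2,2b)` with `⌈n/2⌉` ones and `b` odd
square-free. -/
theorem stmt_10 (n : ℕ) (hn : 2 ≤ n)
    (A : Matrix (Fin n) (Fin n) ℤ)
    (hA_symm : Aᵀ = A)
    (hA_diag : ∀ i, A i i = 0)
    (hA_01 : ∀ i j, A i j = 0 ∨ A i j = 1)
    (W : Matrix (Fin n) (Fin n) ℤ)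
    (hW : W = Matrix.of fun (i j : Fin n) => (A ^ (j : ℕ)).mulVec (fun _ => (1 : ℤ)) i)
    (hF : ∃ ε b : ℤ, (ε = 1 ∨ ε = -1) ∧ Odd b ∧ Squarefree b ∧
      W.det = ε * 2 ^ (n / 2) * b) :
    (W.map (Int.cast : ℤ → ZMod 2)).rank = (n + 1) / 2 ∧
    ∃ (U V : Matrix (Fin n) (Fin n) ℤ) (b : ℤ),
      (U.det = 1 ∨ U.det = -1) ∧ (V.det = 1 ∨ V.det = -1) ∧
      Odd b ∧ Squarefree b ∧
      U * W * V = Matrix.diagonal (fun i : Fin n =>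
        if (i : ℕ) < (n + 1) / 2 then (1 : ℤ)
        else if (i : ℕ) < n - 1 then 2 else 2 * b) := by
  obtain ⟨ε, b, hε, hb, hsq, hdet⟩ := hF
  have hassoc : Associated (2 ^ (n / 2) * b) W.det := by
    refine ⟨(Int.isUnit_iff.mpr hε).unit, ?_⟩
    rw [hdet, IsUnit.unit_spec]
    ring
  have hdet0 : W.det ≠ 0 := hassoc.ne_zero_iff.mp (mul_ne_zero (by positivity) hsq.ne_zero)
  have hupper : 2 * (W.map (Int.cast : ℤ → ZMod 2)).rank ≤ n + 1 := by
    have hmap : W.map (Int.cast : ℤ → ZMod 2) = Matrix.of fun (i j : Fin n) =>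
        ((A.map (Int.cast : ℤ → ZMod 2)) ^ (j : ℕ) *ᵥ 1) i := by
      ext i j
      have hpow : (A ^ (j : ℕ)).map (Int.cast : ℤ → ZMod 2) = (A.map Int.cast) ^ (j : ℕ) :=
        map_pow (Int.castRingHom (ZMod 2)).mapMatrix A j
      simp [hW, ← hpow, mulVec, dotProduct]
    rw [hmap]
    refine rank_walkMatrix_zmod_two_le _ ?_ fun i => by simp [hA_diag]
    rw [← transpose_map, hA_symm]
  obtain ⟨a, ha⟩ := exists_unimodularEquiv_diagonal W hdet0
  have hprod : Associated (2 ^ (n / 2) * b) (∏ i, a i) := by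
    rw [← det_diagonal]
    exact hassoc.trans ha.associated_det
  have hrank := rank_map_diagonal_zmod_two a
  rw [← ha.rank_map_eq, Fintype.card_fin] at hrank
  have hle : (Finset.univ.filter fun i => Even (a i)).card ≤ n / 2 := by
    have h1 := (two_pow_card_even_dvd_prod a).trans hprod.symm.dvd
    have hcop : IsCoprime ((2 : ℤ) ^ (Finset.univ.filter fun i => Even (a i)).card) b :=
      (Int.isCoprime_two_left.mpr hb).pow_left
    have h2 := hcop.dvd_of_dvd_mul_right h1
    exact (pow_dvd_pow_iff (by norm_num) (by decide)).mp h2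
  have hcard : (Finset.univ.filter fun i => Even (a i)).card = n / 2 := by omega
  refine ⟨by omega, ?_⟩
  obtain ⟨σ, hσ⟩ := exists_perm_iff_of_card_eq (fun i : Fin n => (n + 1) / 2 ≤ (i : ℕ))
    (fun i => Even (a i)) (by
      rw [hcard]
      have h1 := Finset.card_filter_add_card_filter_not (s := (Finset.univ : Finset (Fin n)))
        (fun i => (i : ℕ) < (n + 1) / 2)
      simp only [Fin.card_filter_val_lt, not_lt, Finset.card_univ, Fintype.card_fin] at h1
      omega)
  let l : Fin n := ⟨n - 1, by omega⟩
  have hcard' : (Finset.univ.filter fun i => Even ((a ∘ σ) i)).card = n / 2 := by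
    rw [← hcard]
    exact Finset.card_equiv σ (by simp)
  obtain ⟨b', hb', hsq', hequiv⟩ := unimodularEquiv_diagonal_of_squarefree (a ∘ σ) b hb hsq
    (by rw [hcard']; simpa only [Function.comp_apply, Equiv.prod_comp] using hprod.symm)
    l ((hσ l).mpr (by simp only [l]; omega))
  obtain ⟨U, V, hU, hV, hUV⟩ := (ha.trans (UnimodularEquiv.diagonal_perm a σ)).trans hequiv
  refine ⟨U, V, b', Int.isUnit_iff.mp hU, Int.isUnit_iff.mp hV, hb', hsq', ?_⟩
  rw [hUV]
  congr 1
  funext i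
  simp only [Function.comp_apply, hσ, l, Fin.ext_iff]
  have := i.isLt
  split_ifs <;> first | rfl | omega
end
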